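/- Fix d ≥ 1, let P ⊆ EuclideanSpace ℝ (Fin (d+1)) be a convex polytope with nonempty interior, let S = frontier P, and let v ∈ S be a source point lying in the relative interior of a face of P of dimension d. Then every point of S lying in a face of P of dimension at most d−2 belongs to the closure of the set K_v of cut points; that is, S_{d−2} ⊆ closure(K_v). (Proposition 2.5 of the paper: every warped point lies in the cut locus.) -/

import Mathlib

open scoped RealInnerProductSpace ENNReal

/-- A path in `S` from `a` to `b`: a continuous map `γ` on `[0,1]` with
`γ 0 = a`, `γ 1 = b`, and image contained in `S`. -/
def IsPathIn {E : Type*} [NormedAddCommGroup E] [InnerProductSpace ℝ E]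
    (S : Set E) (a b : E) (γ : ℝ → E) : Prop :=
  ContinuousOn γ (Set.Icc 0 1) ∧ γ 0 = a ∧ γ 1 = b ∧ Set.MapsTo γ (Set.Icc 0 1) S

/-- The length of a path: its total variation on `[0,1]`. -/
noncomputable def pathLength {E : Type*} [NormedAddCommGroup E] [InnerProductSpace ℝ E]
    (γ : ℝ → E) : ℝ≥0∞ :=
  eVariationOn γ (Set.Icc 0 1)

/-- The intrinsic distance in `S`: the infimum of lengths of paths in `S`
from `a` to `b`. -/
noncomputable def intrinsicDist {E : Type*} [NormedAddCommGroup E] [InnerProductSpace ℝ E]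
    (S : Set E) (a b : E) : ℝ≥0∞ :=
  ⨅ (γ : ℝ → E) (_ : IsPathIn S a b γ), pathLength γ

/-- A shortest path in `S` from `a` to `b`: a path in `S` from `a` to `b` whose
length equals the intrinsic distance `μ(a,b)`. -/
def IsShortestPath {E : Type*} [NormedAddCommGroup E] [InnerProductSpace ℝ E]
    (S : Set E) (a b : E) (γ : ℝ → E) : Prop :=
  IsPathIn S a b γ ∧ pathLength γ = intrinsicDist S a b

/-- A face of `P`: a nonempty convex subset of `P` that is extreme in `P`. -/
def IsFace {E : Type*} [NormedAddCommGroup E] [InnerProductSpace ℝ E]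
    (P F : Set E) : Prop :=
  F.Nonempty ∧ Convex ℝ F ∧ IsExtreme ℝ P F

/-- The dimension of a face: the dimension of its affine span. -/
noncomputable def faceDim {E : Type*} [NormedAddCommGroup E] [InnerProductSpace ℝ E]
    (F : Set E) : ℕ :=
  Module.finrank ℝ (affineSpan ℝ F).direction

/-- A point `x` is a cut point for the source `v` on `frontier P` if there are
two shortest paths in `frontier P` from `v` to `x` with distinct images. -/
def IsCutPoint {E : Type*} [NormedAddCommGroup E] [InnerProductSpace ℝ E]
    (P : Set E) (v x : E) : Prop :=
  ∃ γ₁ γ₂ : ℝ → E,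
    IsShortestPath (frontier P) v x γ₁ ∧ IsShortestPath (frontier P) v x γ₂ ∧
      γ₁ '' Set.Icc 0 1 ≠ γ₂ '' Set.Icc 0 1

section Warped

open Set Filter Topology

section Paths

variable {E : Type*} [NormedAddCommGroup E] [InnerProductSpace ℝ E] {S : Set E} {a b c : E}

theorem intrinsicDist_le_pathLength {γ : ℝ → E} (h : IsPathIn S a b γ) :
    intrinsicDist S a b ≤ pathLength γ :=
  iInf₂_le γ h

theorem edist_le_pathLength {γ : ℝ → E} (h : IsPathIn S a b γ) : edist a b ≤ pathLength γ := by
  rw [← h.2.1, ← h.2.2.1]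
  exact eVariationOn.edist_le γ (by simp) (by simp)

theorem edist_le_intrinsicDist (S : Set E) (a b : E) : edist a b ≤ intrinsicDist S a b :=
  le_iInf₂ fun _ h => edist_le_pathLength h

theorem image_lineMap_Icc {s t : ℝ} (hst : s ≤ t) :
    AffineMap.lineMap (k := ℝ) s t '' Icc (0 : ℝ) 1 = Icc s t := by
  rw [← segment_eq_image_lineMap, segment_eq_Icc hst]

theorem isPathIn_comp_lineMap {γ : ℝ → E} {s t : ℝ} (hst : s ≤ t)
    (hc : ContinuousOn γ (Icc s t)) (hm : MapsTo γ (Icc s t) S) :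
    IsPathIn S (γ s) (γ t) (γ ∘ AffineMap.lineMap (k := ℝ) s t) := by
  have him : MapsTo (AffineMap.lineMap (k := ℝ) s t) (Icc (0 : ℝ) 1) (Icc s t) := by
    rw [← image_lineMap_Icc hst]; exact mapsTo_image _ _
  refine ⟨hc.comp ?_ him, by simp, by simp, hm.comp him⟩
  exact (AffineMap.lineMap_continuous (R := ℝ)).continuousOn

theorem pathLength_comp_lineMap (γ : ℝ → E) {s t : ℝ} (hst : s ≤ t) :
    pathLength (γ ∘ AffineMap.lineMap (k := ℝ) s t) = eVariationOn γ (Icc s t) := by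
  rw [pathLength, eVariationOn.comp_eq_of_monotoneOn, image_lineMap_Icc hst]
  intro x _ y _ hxy
  simp only [AffineMap.lineMap_apply, vsub_eq_sub, smul_eq_mul, vadd_eq_add]
  nlinarith

theorem intrinsicDist_le_eVariationOn {γ : ℝ → E} {s t : ℝ} (hst : s ≤ t)
    (hc : ContinuousOn γ (Icc s t)) (hm : MapsTo γ (Icc s t) S) :
    intrinsicDist S (γ s) (γ t) ≤ eVariationOn γ (Icc s t) := by
  rw [← pathLength_comp_lineMap γ hst]
  exact intrinsicDist_le_pathLength (isPathIn_comp_lineMap hst hc hm)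

theorem IsPathIn.exists_concat {γ₁ γ₂ : ℝ → E} (h₁ : IsPathIn S a b γ₁) (h₂ : IsPathIn S b c γ₂) :
    ∃ γ, IsPathIn S a c γ ∧ pathLength γ = pathLength γ₁ + pathLength γ₂ ∧
      γ '' Icc 0 1 = γ₁ '' Icc 0 1 ∪ γ₂ '' Icc 0 1 := by
  set δ : ℝ → E := fun t => if t ≤ 1 then γ₁ t else γ₂ (t - 1) with hδ
  have e₁ : EqOn δ γ₁ (Icc 0 1) := fun t ht => by simp [hδ, ht.2]
  have e₂ : EqOn δ (γ₂ ∘ fun t => t - 1) (Icc 1 2) := fun t ht => by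
    by_cases h : t ≤ 1
    · have : t = 1 := le_antisymm h ht.1
      subst this
      simp [hδ, h₁.2.2.1, h₂.2.1]
    · simp [hδ, h]
  have hshift : (fun t : ℝ => t - 1) '' Icc (1 : ℝ) 2 = Icc 0 1 := by
    rw [image_sub_const_Icc]; norm_num
  have hu : Icc (0 : ℝ) 2 = Icc 0 1 ∪ Icc 1 2 :=
    (Icc_union_Icc_eq_Icc (by norm_num) (by norm_num)).symm
  have hmt : MapsTo (fun t : ℝ => t - 1) (Icc (1 : ℝ) 2) (Icc 0 1) := by
    rw [← hshift]; exact mapsTo_image _ _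
  have hc : ContinuousOn δ (Icc 0 2) := by
    rw [hu]
    refine ContinuousOn.union_of_isClosed ?_ ?_ isClosed_Icc isClosed_Icc
    · exact h₁.1.congr e₁
    · exact (h₂.1.comp (by fun_prop) hmt).congr e₂
  have hm : MapsTo δ (Icc 0 2) S := by
    rw [hu]
    refine MapsTo.union ?_ ?_
    · exact h₁.2.2.2.congr e₁.symm
    · exact (h₂.2.2.2.comp hmt).congr e₂.symm
  have h02 : (0 : ℝ) ≤ 2 := by norm_num
  refine ⟨δ ∘ AffineMap.lineMap (k := ℝ) 0 2, ?_, ?_, ?_⟩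
  · have := isPathIn_comp_lineMap h02 hc hm
    have z : δ 0 = a := by simp [hδ, h₁.2.1]
    have w : δ 2 = c := by norm_num [hδ, h₂.2.2.1]
    rwa [z, w] at this
  · rw [pathLength_comp_lineMap δ h02]
    have := eVariationOn.Icc_add_Icc δ (s := univ) (a := (0 : ℝ)) (b := 1) (c := 2)
      (by norm_num) (by norm_num) (mem_univ _)
    simp only [univ_inter] at this
    rw [← this, eVariationOn.congr e₁, eVariationOn.congr e₂,
      eVariationOn.comp_eq_of_monotoneOn _ _ (fun x _ y _ h => by simpa using h), hshift]
    rfl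
  · rw [image_comp, image_lineMap_Icc h02, hu, image_union, e₁.image_eq, e₂.image_eq, image_comp,
      hshift]

theorem intrinsicDist_triangle (S : Set E) (a b c : E) :
    intrinsicDist S a c ≤ intrinsicDist S a b + intrinsicDist S b c := by
  rw [intrinsicDist, intrinsicDist, intrinsicDist]
  refine ENNReal.le_of_forall_pos_le_add fun ε hε hfin => ?_
  have hε' : (ε : ℝ≥0∞) / 2 ≠ 0 := by simp [hε.ne']
  obtain ⟨hf₁, hf₂⟩ := ENNReal.add_lt_top.1 hfin
  obtain ⟨γ₁, h₁⟩ := iInf_lt_iff.1 (ENNReal.lt_add_right hf₁.ne hε')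
  obtain ⟨p₁, h₁⟩ := iInf_lt_iff.1 h₁
  obtain ⟨γ₂, h₂⟩ := iInf_lt_iff.1 (ENNReal.lt_add_right hf₂.ne hε')
  obtain ⟨p₂, h₂⟩ := iInf_lt_iff.1 h₂
  obtain ⟨γ, p, hl, -⟩ := p₁.exists_concat p₂
  refine (iInf₂_le γ p).trans ?_
  rw [hl]
  refine (add_le_add h₁.le h₂.le).trans ?_
  rw [add_add_add_comm, ENNReal.add_halves]

theorem intrinsicDist_comm (S : Set E) (a b : E) : intrinsicDist S a b = intrinsicDist S b a := by
  have key : ∀ a b : E, intrinsicDist S a b ≤ intrinsicDist S b a := by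
    intro a b
    refine le_iInf₂ fun γ h => ?_
    have hm : MapsTo (fun t : ℝ => 1 - t) (Icc (0 : ℝ) 1) (Icc 0 1) := fun t ht =>
      ⟨by linarith [ht.2], by linarith [ht.1]⟩
    have hp : IsPathIn S a b (γ ∘ fun t => 1 - t) :=
      ⟨h.1.comp (by fun_prop) hm, by simp [h.2.2.1], by simp [h.2.1], h.2.2.2.comp hm⟩
    refine (intrinsicDist_le_pathLength hp).trans ?_
    exact eVariationOn.comp_le_of_antitoneOn _ _ (fun x _ y _ h => sub_le_sub_left h 1) hm
  exact le_antisymm (key a b) (key b a)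

theorem pathLength_le_of_dist_le {γ : ℝ → E} {D : ℝ} (hD : 0 ≤ D)
    (h : ∀ s ∈ Icc (0 : ℝ) 1, ∀ t ∈ Icc (0 : ℝ) 1, dist (γ s) (γ t) ≤ D * dist s t) :
    pathLength γ ≤ ENNReal.ofReal D := by
  have hl : LipschitzOnWith D.toNNReal γ (Icc 0 1) := by
    refine LipschitzOnWith.of_dist_le_mul fun s hs t ht => ?_
    rw [Real.coe_toNNReal D hD]
    exact h s hs t ht
  have h1 := hl.comp_eVariationOn_le (f := γ) (g := id) (s := Icc (0 : ℝ) 1) (mapsTo_id _)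
  have h2 : eVariationOn (id : ℝ → ℝ) (Icc (0 : ℝ) 1) = 1 := by
    have := MonotoneOn.eVariationOn_eq (f := (id : ℝ → ℝ)) (s := Icc (0 : ℝ) 1) (a := 0) (b := 1)
      (monotone_id.monotoneOn _) (by simp) (by simp)
    simp_all
  rw [h2, mul_one] at h1
  exact h1

end Paths

theorem continuousOn_of_dist_le_mul {X : Type*} [PseudoMetricSpace X] {γ : ℝ → X} {D : ℝ} (hD : 0 ≤ D) {s : Set ℝ}
    (h : ∀ x ∈ s, ∀ y ∈ s, dist (γ x) (γ y) ≤ D * dist x y) : ContinuousOn γ s := by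
  have hl : LipschitzOnWith D.toNNReal γ s := by
    refine LipschitzOnWith.of_dist_le_mul fun x hx y hy => ?_
    rw [Real.coe_toNNReal D hD]
    exact h x hx y hy
  exact hl.continuousOn

section Geodesics

variable {E : Type*} [NormedAddCommGroup E] [InnerProductSpace ℝ E] {S : Set E}

/-- A compact set, any two points of which are joined by a path of finite length in the set, and
whose intrinsic distance to any given point agrees locally with the ambient distance. -/
structure IsGeodesicCompact (S : Set E) : Prop where
  isCompact : IsCompact S
  ne_top : ∀ a ∈ S, ∀ b ∈ S, intrinsicDist S a b ≠ ⊤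
  locally_le : ∀ x ∈ S, ∃ δ > 0, ∀ y ∈ S, dist x y < δ → intrinsicDist S x y ≤ edist x y

/-- The intrinsic distance as a real number. -/
noncomputable def surfDist (S : Set E) (a b : E) : ℝ :=
  (intrinsicDist S a b).toReal

theorem surfDist_comm (S : Set E) (a b : E) : surfDist S a b = surfDist S b a := by
  rw [surfDist, intrinsicDist_comm, surfDist]

theorem surfDist_nonneg (S : Set E) (a b : E) : 0 ≤ surfDist S a b :=
  ENNReal.toReal_nonneg

namespace IsGeodesicCompact

variable (hS : IsGeodesicCompact S)
include hS

theorem dist_le_surfDist {a b : E} (ha : a ∈ S) (hb : b ∈ S) : dist a b ≤ surfDist S a b := by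
  rw [dist_edist]
  exact ENNReal.toReal_mono (hS.ne_top a ha b hb) (edist_le_intrinsicDist S a b)

theorem surfDist_triangle {a b c : E} (ha : a ∈ S) (hb : b ∈ S) (hc : c ∈ S) :
    surfDist S a c ≤ surfDist S a b + surfDist S b c := by
  rw [surfDist, surfDist, surfDist,
    ← ENNReal.toReal_add (hS.ne_top a ha b hb) (hS.ne_top b hb c hc)]
  exact ENNReal.toReal_mono (ENNReal.add_ne_top.2 ⟨hS.ne_top a ha b hb, hS.ne_top b hb c hc⟩)
    (intrinsicDist_triangle S a b c)

theorem exists_surfDist_eq_dist {x : E} (hx : x ∈ S) :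
    ∃ δ > 0, ∀ y ∈ S, dist x y < δ → surfDist S x y = dist x y := by
  obtain ⟨δ, hδ, h⟩ := hS.locally_le x hx
  refine ⟨δ, hδ, fun y hy hxy => le_antisymm ?_ (hS.dist_le_surfDist hx hy)⟩
  rw [dist_edist]
  exact ENNReal.toReal_mono (edist_ne_top _ _) (h y hy hxy)

theorem surfDist_self {x : E} (hx : x ∈ S) : surfDist S x x = 0 := by
  obtain ⟨δ, hδ, h⟩ := hS.exists_surfDist_eq_dist hx
  simpa [hδ] using h x hx

theorem eq_of_surfDist_eq_zero {a b : E} (ha : a ∈ S) (hb : b ∈ S) (h : surfDist S a b = 0) :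
    a = b :=
  dist_le_zero.1 (h ▸ hS.dist_le_surfDist ha hb)

theorem tendsto_surfDist_self {x : E} (hx : x ∈ S) :
    Tendsto (fun y => surfDist S x y) (𝓝[S] x) (𝓝 0) := by
  obtain ⟨δ, hδ, h⟩ := hS.exists_surfDist_eq_dist hx
  have h1 : Tendsto (fun y => dist x y) (𝓝[S] x) (𝓝 0) := by
    have : Tendsto (fun y => dist x y) (𝓝 x) (𝓝 (dist x x)) :=
      (continuous_const.dist continuous_id).tendsto x
    rw [dist_self] at this
    exact this.mono_left nhdsWithin_le_nhds
  refine h1.congr' ?_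
  filter_upwards [self_mem_nhdsWithin, mem_nhdsWithin_of_mem_nhds (Metric.ball_mem_nhds x hδ)]
    with y hy hyδ
  rw [h y hy (by rwa [dist_comm])]

theorem tendsto_surfDist {ι : Type*} {l : Filter ι} {f g : ι → E} {x y : E} (hx : x ∈ S)
    (hy : y ∈ S) (hfS : ∀ᶠ i in l, f i ∈ S) (hgS : ∀ᶠ i in l, g i ∈ S) (hf : Tendsto f l (𝓝 x))
    (hg : Tendsto g l (𝓝 y)) :
    Tendsto (fun i => surfDist S (f i) (g i)) l (𝓝 (surfDist S x y)) := by
  have h1 := (hS.tendsto_surfDist_self hx).comp (tendsto_nhdsWithin_iff.2 ⟨hf, hfS⟩)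
  have h2 := (hS.tendsto_surfDist_self hy).comp (tendsto_nhdsWithin_iff.2 ⟨hg, hgS⟩)
  rw [tendsto_iff_dist_tendsto_zero]
  refine squeeze_zero' (.of_forall fun _ => dist_nonneg) ?_ (by simpa using h1.add h2)
  filter_upwards [hfS, hgS] with i hfi hgi
  have t1 := hS.surfDist_triangle hx hfi hgi
  have t2 := hS.surfDist_triangle hx hgi hy
  have t3 := hS.surfDist_triangle hfi hx hy
  have t4 := hS.surfDist_triangle hfi hy hgi
  have c1 := surfDist_comm S (f i) x
  have c2 := surfDist_comm S (g i) y
  rw [Real.dist_eq, abs_le]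
  constructor <;> linarith

theorem continuousOn_surfDist {v : E} (hv : v ∈ S) : ContinuousOn (fun y => surfDist S v y) S :=
  fun _ hx => hS.tendsto_surfDist hv hx (.of_forall fun _ => hv) self_mem_nhdsWithin
    tendsto_const_nhds (tendsto_id.mono_left nhdsWithin_le_nhds)

theorem isShortestPath_of_pathLength_le {a b : E} {γ : ℝ → E} (ha : a ∈ S) (hb : b ∈ S)
    (h : IsPathIn S a b γ) (hl : pathLength γ ≤ ENNReal.ofReal (surfDist S a b)) :
    IsShortestPath S a b γ := by
  refine ⟨h, le_antisymm ?_ (intrinsicDist_le_pathLength h)⟩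
  rwa [surfDist, ENNReal.ofReal_toReal (hS.ne_top a ha b hb)] at hl

/-- Along a path of finite length, the pieces between intermediate points are not longer than the
path. -/
theorem surfDist_add_dist_add_surfDist_le {a b : E} {γ : ℝ → E} (ha : a ∈ S) (hb : b ∈ S)
    (h : IsPathIn S a b γ) (hl : pathLength γ ≠ ⊤) {s t : ℝ} (h0 : 0 ≤ s) (hst : s ≤ t)
    (h1 : t ≤ 1) :
    surfDist S a (γ s) + dist (γ s) (γ t) + surfDist S (γ t) b ≤ (pathLength γ).toReal := by
  have hs : γ s ∈ S := h.2.2.2 ⟨h0, hst.trans h1⟩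
  have ht : γ t ∈ S := h.2.2.2 ⟨h0.trans hst, h1⟩
  have e1 := eVariationOn.Icc_add_Icc γ (s := univ) h0 hst (mem_univ _)
  have e2 := eVariationOn.Icc_add_Icc γ (s := univ) (h0.trans hst) h1 (mem_univ _)
  simp only [univ_inter] at e1 e2
  have l1 : intrinsicDist S a (γ s) ≤ eVariationOn γ (Icc 0 s) := by
    have := intrinsicDist_le_eVariationOn (S := S) h0 (h.1.mono (Icc_subset_Icc_right (hst.trans h1)))
      (h.2.2.2.mono_left (Icc_subset_Icc_right (hst.trans h1)))
    rwa [h.2.1] at this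
  have l2 : edist (γ s) (γ t) ≤ eVariationOn γ (Icc s t) :=
    eVariationOn.edist_le γ (by simp [hst]) (by simp [hst])
  have l3 : intrinsicDist S (γ t) b ≤ eVariationOn γ (Icc t 1) := by
    have := intrinsicDist_le_eVariationOn (S := S) h1 (h.1.mono (Icc_subset_Icc_left (h0.trans hst)))
      (h.2.2.2.mono_left (Icc_subset_Icc_left (h0.trans hst)))
    rwa [h.2.2.1] at this
  rw [surfDist, surfDist, dist_edist,
    ← ENNReal.toReal_add (hS.ne_top _ ha _ hs) (edist_ne_top _ _),
    ← ENNReal.toReal_add (ENNReal.add_ne_top.2 ⟨hS.ne_top _ ha _ hs, edist_ne_top _ _⟩)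
      (hS.ne_top _ ht _ hb)]
  refine ENNReal.toReal_mono hl ?_
  rw [pathLength, ← e2, ← e1]
  gcongr

theorem exists_almost_geodesic {a b : E} (ha : a ∈ S) (hb : b ∈ S) {ε : ℝ} (hε : 0 < ε) :
    ∃ g : ℝ → E, (∀ s, g s ∈ S) ∧ dist a (g 0) ≤ ε ∧ dist (g 1) b ≤ ε ∧
      ∀ s ∈ Icc (0 : ℝ) 1, ∀ t ∈ Icc (0 : ℝ) 1,
        dist (g s) (g t) ≤ surfDist S a b * dist s t + ε := by
  set D := surfDist S a b with hD
  have hD0 : 0 ≤ D := surfDist_nonneg _ _ _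
  have hlt : intrinsicDist S a b < intrinsicDist S a b + ENNReal.ofReal ε :=
    ENNReal.lt_add_right (hS.ne_top a ha b hb) (by simpa using hε)
  obtain ⟨γ, h1⟩ := iInf_lt_iff.1 hlt
  obtain ⟨hγ, h1⟩ := iInf_lt_iff.1 h1
  have hfin : pathLength γ ≠ ⊤ := (h1.trans_le le_top).ne
  have hlen : (pathLength γ).toReal ≤ D + ε := by
    have := ENNReal.toReal_mono
      (ENNReal.add_ne_top.2 ⟨hS.ne_top a ha b hb, ENNReal.ofReal_ne_top⟩) h1.le
    rwa [ENNReal.toReal_add (hS.ne_top a ha b hb) ENNReal.ofReal_ne_top,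
      ENNReal.toReal_ofReal hε.le] at this
  set φ : ℝ → ℝ := fun τ => surfDist S a (γ τ) with hφ
  have hφc : ContinuousOn φ (Icc 0 1) := (hS.continuousOn_surfDist ha).comp hγ.1 hγ.2.2.2
  have hφ0 : φ 0 = 0 := by simp [hφ, hγ.2.1, hS.surfDist_self ha]
  have hφ1 : φ 1 = D := by simp [hφ, hγ.2.2.1, hD]
  have hτ : ∀ s : ℝ, ∃ τ ∈ Icc (0 : ℝ) 1, s ∈ Icc (0 : ℝ) 1 → φ τ = s * D ∧
      ∀ τ' ∈ Icc (0 : ℝ) 1, s * D ≤ φ τ' → τ ≤ τ' := by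
    intro s
    by_cases hs : s ∈ Icc (0 : ℝ) 1
    swap
    · exact ⟨0, by simp, fun h => absurd h hs⟩
    have hsD : 0 ≤ s * D := mul_nonneg hs.1 hD0
    set T := Icc (0 : ℝ) 1 ∩ φ ⁻¹' Ici (s * D) with hT
    have hTc : IsCompact T :=
      isCompact_Icc.of_isClosed_subset (hφc.preimage_isClosed_of_isClosed isClosed_Icc isClosed_Ici)
        inter_subset_left
    have hTn : T.Nonempty := ⟨1, by simp, by
      simp only [mem_preimage, mem_Ici, hφ1]; nlinarith [hs.2]⟩
    have hmem := hTc.sInf_mem hTn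
    set σ := sInf T with hσ
    have hmin : ∀ τ' ∈ Icc (0 : ℝ) 1, s * D ≤ φ τ' → σ ≤ τ' := fun τ' h h' =>
      csInf_le hTc.bddBelow ⟨h, h'⟩
    refine ⟨σ, hmem.1, fun _ => ⟨?_, hmin⟩⟩
    obtain ⟨τ', hτ', hval⟩ := intermediate_value_Icc hmem.1.1
      (hφc.mono (Icc_subset_Icc_right hmem.1.2)) (show s * D ∈ Icc (φ 0) (φ σ) from
        ⟨by rw [hφ0]; exact hsD, hmem.2⟩)
    have : σ ≤ τ' := hmin τ' ⟨hτ'.1, hτ'.2.trans hmem.1.2⟩ hval.ge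
    rw [← hval, le_antisymm this hτ'.2]
  choose τ hτI hτ using hτ
  have key : ∀ s ∈ Icc (0 : ℝ) 1, ∀ t ∈ Icc (0 : ℝ) 1, s ≤ t →
      dist (γ (τ s)) (γ (τ t)) ≤ D * dist s t + ε := by
    intro s hs t ht hst
    have hm : τ s ≤ τ t := (hτ s hs).2 _ (hτI t) (by rw [(hτ t ht).1]; gcongr)
    have := hS.surfDist_add_dist_add_surfDist_le ha hb hγ hfin (hτI s).1 hm (hτI t).2
    have e1 : surfDist S a (γ (τ s)) = s * D := (hτ s hs).1
    have e2 : surfDist S a (γ (τ t)) = t * D := (hτ t ht).1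
    have e3 := hS.surfDist_triangle ha (hγ.2.2.2 (hτI t)) hb
    rw [Real.dist_eq, abs_of_nonpos (by linarith)]
    rw [← hD] at e3
    nlinarith
  refine ⟨fun s => γ (τ s), fun s => hγ.2.2.2 (hτI s), ?_, ?_, ?_⟩
  · have e1 : surfDist S a (γ (τ 0)) = 0 * D := (hτ 0 (by simp)).1
    have := hS.dist_le_surfDist ha (hγ.2.2.2 (hτI 0))
    simp only
    linarith
  · have := hS.surfDist_add_dist_add_surfDist_le ha hb hγ hfin (hτI 1).1 le_rfl (hτI 1).2
    have e1 : surfDist S a (γ (τ 1)) = 1 * D := (hτ 1 (by simp)).1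
    have e2 := hS.dist_le_surfDist (hγ.2.2.2 (hτI 1)) hb
    rw [dist_self] at this
    simp only
    linarith
  · intro s hs t ht
    rcases le_total s t with h | h
    · exact key s hs t ht h
    · rw [dist_comm, dist_comm s t]
      exact key t ht s hs h

theorem exists_geodesic {a b : E} (ha : a ∈ S) (hb : b ∈ S) :
    ∃ g : ℝ → E, IsShortestPath S a b g ∧
      (∀ t ∈ Icc (0 : ℝ) 1, surfDist S a (g t) = t * surfDist S a b) ∧
      ∀ t ∈ Icc (0 : ℝ) 1, surfDist S (g t) b = (1 - t) * surfDist S a b := by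
  set D := surfDist S a b with hD
  have hD0 : 0 ≤ D := surfDist_nonneg _ _ _
  let K : ℕ → Set (ℝ → E) := fun n => univ.pi (fun _ => S) ∩
    {g | dist a (g 0) ≤ 1 / (n + 1 : ℝ) ∧ dist (g 1) b ≤ 1 / (n + 1 : ℝ) ∧
      ∀ s ∈ Icc (0 : ℝ) 1, ∀ t ∈ Icc (0 : ℝ) 1, dist (g s) (g t) ≤ D * dist s t + 1 / (n + 1 : ℝ)}
  have hKcl : ∀ n, IsClosed (K n) := by
    intro n
    refine (isClosed_set_pi fun _ _ => hS.isCompact.isClosed).inter ?_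
    simp only [ofPred_and, ofPred_forall]
    refine (isClosed_le (by fun_prop) (by fun_prop)).inter
      ((isClosed_le (by fun_prop) (by fun_prop)).inter ?_)
    exact isClosed_iInter fun s => isClosed_iInter fun _ => isClosed_iInter fun t =>
      isClosed_iInter fun _ => isClosed_le (by fun_prop) (by fun_prop)
  have hanti : ∀ n, K (n + 1) ⊆ K n := by
    rintro n g ⟨h1, h2, h3, h4⟩
    have hle : 1 / ((n + 1 : ℕ) + 1 : ℝ) ≤ 1 / (n + 1 : ℝ) :=
      one_div_le_one_div_of_le (by positivity) (by push_cast; linarith)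
    exact ⟨h1, h2.trans hle, h3.trans hle, fun s hs t ht => (h4 s hs t ht).trans (by gcongr)⟩
  have hne : ∀ n, (K n).Nonempty := by
    intro n
    obtain ⟨g, h1, h2, h3, h4⟩ := hS.exists_almost_geodesic ha hb
      (show (0 : ℝ) < 1 / (n + 1 : ℝ) by positivity)
    exact ⟨g, fun s _ => h1 s, h2, h3, h4⟩
  have hK0 : IsCompact (K 0) :=
    (isCompact_univ_pi fun _ => hS.isCompact).of_isClosed_subset (hKcl 0) inter_subset_left
  obtain ⟨g, hg⟩ := IsCompact.nonempty_iInter_of_sequence_nonempty_isCompact_isClosed K hanti hne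
    hK0 hKcl
  have hg : ∀ n, g ∈ K n := mem_iInter.1 hg
  have hgS : ∀ t, g t ∈ S := fun t => (hg 0).1 t (mem_univ t)
  have hlim : Tendsto (fun n : ℕ => 1 / ((n : ℝ) + 1)) atTop (𝓝 0) :=
    tendsto_one_div_add_atTop_nhds_zero_nat
  have hg0 : g 0 = a := (dist_le_zero.1 (ge_of_tendsto' hlim fun n => (hg n).2.1)).symm
  have hg1 : g 1 = b := dist_le_zero.1 (ge_of_tendsto' hlim fun n => (hg n).2.2.1)
  have hlip : ∀ s ∈ Icc (0 : ℝ) 1, ∀ t ∈ Icc (0 : ℝ) 1, dist (g s) (g t) ≤ D * dist s t := by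
    intro s hs t ht
    have : Tendsto (fun n : ℕ => D * dist s t + 1 / ((n : ℝ) + 1)) atTop (𝓝 (D * dist s t + 0)) :=
      hlim.const_add _
    rw [add_zero] at this
    exact ge_of_tendsto' this fun n => (hg n).2.2.2 s hs t ht
  have hpath : IsPathIn S a b g :=
    ⟨continuousOn_of_dist_le_mul hD0 hlip, hg0, hg1, fun t _ => hgS t⟩
  have hlen : pathLength g ≤ ENNReal.ofReal D := pathLength_le_of_dist_le hD0 hlip
  have hup : ∀ s t, 0 ≤ s → s ≤ t → t ≤ 1 → surfDist S (g s) (g t) ≤ D * (t - s) := by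
    intro s t h0 hst h1
    have hp := isPathIn_comp_lineMap hst (hpath.1.mono (Icc_subset_Icc h0 h1))
      (fun t _ => hgS t : MapsTo g (Icc s t) S)
    have hl : pathLength (g ∘ AffineMap.lineMap (k := ℝ) s t) ≤ ENNReal.ofReal (D * (t - s)) := by
      refine pathLength_le_of_dist_le (mul_nonneg hD0 (by linarith)) fun x hx y hy => ?_
      have hmem : ∀ x ∈ Icc (0 : ℝ) 1, AffineMap.lineMap (k := ℝ) s t x ∈ Icc (0 : ℝ) 1 := by
        intro x hx
        have : AffineMap.lineMap (k := ℝ) s t x ∈ Icc s t := by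
          rw [← image_lineMap_Icc hst]; exact mem_image_of_mem _ hx
        exact ⟨h0.trans this.1, this.2.trans h1⟩
      refine (hlip _ (hmem x hx) _ (hmem y hy)).trans_eq ?_
      rw [dist_lineMap_lineMap, Real.dist_eq s t, abs_of_nonpos (by linarith)]
      ring
    have := ENNReal.toReal_mono ENNReal.ofReal_ne_top ((intrinsicDist_le_pathLength hp).trans hl)
    rwa [ENNReal.toReal_ofReal (mul_nonneg hD0 (by linarith))] at this
  refine ⟨g, hS.isShortestPath_of_pathLength_le ha hb hpath hlen, fun t ht => ?_, fun t ht => ?_⟩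
  all_goals
    have u1 := hup 0 t le_rfl ht.1 ht.2
    have u2 := hup t 1 ht.1 ht.2 le_rfl
    have u3 := hS.surfDist_triangle ha (hgS t) hb
    rw [hg0] at u1
    rw [hg1] at u2
    rw [← hD] at u3
    linarith

theorem exists_between {a b : E} (ha : a ∈ S) (hb : b ∈ S) {t : ℝ} (ht : t ∈ Icc (0 : ℝ) 1) :
    ∃ z ∈ S, surfDist S a z = t * surfDist S a b ∧ surfDist S z b = (1 - t) * surfDist S a b := by
  obtain ⟨g, hg, h1, h2⟩ := hS.exists_geodesic ha hb
  exact ⟨g t, hg.1.2.2.2 ht, h1 t ht, h2 t ht⟩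

/-- If all shortest paths between two points have the same image, then a point on them is
determined by its distance to the source. -/
theorem eq_of_between {v y z z' : E} (hv : v ∈ S) (hy : y ∈ S) (hz : z ∈ S) (hz' : z' ∈ S)
    (huniq : ∀ γ₁ γ₂ : ℝ → E, IsShortestPath S v y γ₁ → IsShortestPath S v y γ₂ →
      γ₁ '' Icc 0 1 = γ₂ '' Icc 0 1)
    (h : surfDist S v z + surfDist S z y = surfDist S v y)
    (h' : surfDist S v z' + surfDist S z' y = surfDist S v y)
    (heq : surfDist S v z = surfDist S v z') : z = z' := by
  have through : ∀ z ∈ S, surfDist S v z + surfDist S z y = surfDist S v y →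
      ∃ γ, IsShortestPath S v y γ ∧ z ∈ γ '' Icc 0 1 ∧ ∀ w ∈ γ '' Icc 0 1,
        surfDist S v w = surfDist S v z → w = z := by
    intro z hz h
    obtain ⟨γ₁, p₁, a₁, b₁⟩ := hS.exists_geodesic hv hz
    obtain ⟨γ₂, p₂, a₂, b₂⟩ := hS.exists_geodesic hz hy
    obtain ⟨γ, p, hl, him⟩ := p₁.1.exists_concat p₂.1
    refine ⟨γ, hS.isShortestPath_of_pathLength_le hv hy p ?_, ?_, ?_⟩
    · rw [hl, p₁.2, p₂.2, ← h, ENNReal.ofReal_add (surfDist_nonneg _ _ _) (surfDist_nonneg _ _ _),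
        surfDist, surfDist, ENNReal.ofReal_toReal (hS.ne_top v hv z hz),
        ENNReal.ofReal_toReal (hS.ne_top z hz y hy)]
    · rw [him]
      exact Or.inl ⟨1, by simp, p₁.1.2.2.1⟩
    · rw [him]
      rintro w (⟨t, ht, rfl⟩ | ⟨t, ht, rfl⟩) hw
      · refine hS.eq_of_surfDist_eq_zero (p₁.1.2.2.2 ht) hz ?_
        rw [b₁ t ht, sub_mul, ← a₁ t ht, hw]
        ring
      · refine (hS.eq_of_surfDist_eq_zero hz (p₂.1.2.2.2 ht) ?_).symm
        have t1 := hS.surfDist_triangle hv (p₂.1.2.2.2 ht) hy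
        rw [b₂ t ht, hw, ← h] at t1
        refine le_antisymm ?_ (surfDist_nonneg _ _ _)
        rw [a₂ t ht]
        linarith
  obtain ⟨γ, hγ, hzγ, -⟩ := through z hz h
  obtain ⟨γ', hγ', -, hz'γ'⟩ := through z' hz' h'
  exact hz'γ' z (huniq γ γ' hγ hγ' ▸ hzγ) heq

/-- Where shortest paths are unique, the point dividing them in a given ratio depends continuously
on the endpoint. -/
theorem continuousOn_between {v : E} (hv : v ∈ S) {U : Set E} (hU : U ⊆ S)
    (huniq : ∀ y ∈ U, ∀ γ₁ γ₂ : ℝ → E, IsShortestPath S v y γ₁ → IsShortestPath S v y γ₂ →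
      γ₁ '' Icc 0 1 = γ₂ '' Icc 0 1)
    {t : ℝ} {ζ : E → E} (hζ : ∀ y ∈ U, ζ y ∈ S ∧ surfDist S v (ζ y) = t * surfDist S v y ∧
      surfDist S (ζ y) y = (1 - t) * surfDist S v y) :
    ContinuousOn ζ U := by
  intro y hy
  have hmemU : ∀ᶠ x in 𝓝[U] y, x ∈ U := self_mem_nhdsWithin
  refine hS.isCompact.tendsto_nhds_of_unique_mapClusterPt
    (hmemU.mono fun x hx => (hζ x hx).1) fun w hw hcl => ?_
  obtain ⟨l, hl, hlim⟩ := mapClusterPt_iff_ultrafilter.1 hcl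
  have hid : Tendsto (fun x : E => x) (l : Filter E) (𝓝 y) := hl.trans nhdsWithin_le_nhds
  have hmem : ∀ᶠ x in (l : Filter E), x ∈ U := hl hmemU
  have hζS : ∀ᶠ x in (l : Filter E), ζ x ∈ S := hmem.mono fun x hx => (hζ x hx).1
  have c1 := hS.tendsto_surfDist hv hw (.of_forall fun _ => hv) hζS tendsto_const_nhds hlim
  have c2 := hS.tendsto_surfDist hv (hU hy) (.of_forall fun _ => hv)
    (hmem.mono fun x hx => hU hx) tendsto_const_nhds hid
  have c3 := hS.tendsto_surfDist hw (hU hy) hζS (hmem.mono fun x hx => hU hx) hlim hid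
  have e1 : surfDist S v w = t * surfDist S v y :=
    tendsto_nhds_unique (c1.congr' (hmem.mono fun x hx => (hζ x hx).2.1)) (c2.const_mul t)
  have e2 : surfDist S w y = (1 - t) * surfDist S v y :=
    tendsto_nhds_unique (c3.congr' (hmem.mono fun x hx => (hζ x hx).2.2)) (c2.const_mul (1 - t))
  obtain ⟨f1, f2, f3⟩ := hζ y hy
  exact hS.eq_of_between hv (hU hy) hw f1 (huniq y hy) (by rw [e1, e2]; ring)
    (by rw [f2, f3]; ring) (by rw [e1, f2])

end IsGeodesicCompact

end Geodesics

section ConvexBodies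

variable {E : Type*} [NormedAddCommGroup E] [InnerProductSpace ℝ E]

theorem exists_pos_add_smul_mem {U : Set E} {x : E} (hU : U ∈ 𝓝 x) (u : E) :
    ∃ s > (0 : ℝ), x + s • u ∈ U := by
  have hc : Tendsto (fun s : ℝ => x + s • u) (𝓝[>] 0) (𝓝 x) := by
    have : Tendsto (fun s : ℝ => x + s • u) (𝓝 0) (𝓝 (x + (0 : ℝ) • u)) :=
      Continuous.tendsto (by fun_prop) 0
    rw [zero_smul, add_zero] at this
    exact this.mono_left nhdsWithin_le_nhds
  obtain ⟨s, hs, hs'⟩ := ((hc.eventually hU).and self_mem_nhdsWithin).exists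
  exact ⟨s, hs', hs⟩

theorem Convex.add_smul_mem_of_le {P : Set E} (hP : Convex ℝ P) {x w : E} {s t : ℝ} (hx : x ∈ P)
    (ht : x + t • w ∈ P) (hs : 0 ≤ s) (hst : s ≤ t) : x + s • w ∈ P := by
  rcases hs.eq_or_lt with rfl | hs
  · simpa
  have ht0 : 0 < t := hs.trans_le hst
  have := hP.add_smul_mem hx ht (t := s / t) ⟨by positivity, (div_le_one ht0).2 hst⟩
  rwa [smul_smul, div_mul_cancel₀ _ ht0.ne'] at this

theorem exists_supporting_functional {P : Set E} (hP : Convex ℝ P) (hne : (interior P).Nonempty)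
    {y : E} (hy : y ∉ interior P) :
    ∃ f : StrongDual ℝ E, (∀ z ∈ interior P, f z < f y) ∧ ∀ z ∈ P, f z ≤ f y := by
  obtain ⟨f, hf⟩ := geometric_hahn_banach_open_point hP.interior isOpen_interior hy
  refine ⟨f, hf, fun z hz => ?_⟩
  have hz' : z ∈ closure (interior P) := by
    rw [hP.closure_interior_eq_closure_of_nonempty_interior hne]
    exact subset_closure hz
  exact closure_minimal (t := {w | f w ≤ f y}) (fun w hw => (hf w hw).le)
    (isClosed_le f.continuous continuous_const) hz'

theorem exists_lipschitz_retraction {P : Set E} (hP : Convex ℝ P) (hc : IsCompact P)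
    (hne : P.Nonempty) :
    ∃ π : E → E, (∀ z w, dist (π z) (π w) ≤ dist z w) ∧ (∀ z ∈ P, π z = z) ∧
      ∀ z ∉ interior P, π z ∈ frontier P := by
  have h : ∀ z : E, ∃ p ∈ P, ∀ w ∈ P, ⟪z - p, w - p⟫ ≤ 0 := by
    intro z
    obtain ⟨p, hp, hmin⟩ := exists_norm_eq_iInf_of_complete_convex hne hc.isComplete hP z
    exact ⟨p, hp, (norm_eq_iInf_iff_real_inner_le_zero hP hp).1 hmin⟩
  choose π hπ hπi using h
  have hfix : ∀ z ∈ P, π z = z := by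
    intro z hz
    have := hπi z z hz
    exact (sub_eq_zero.1 (real_inner_self_nonpos.1 this)).symm
  refine ⟨π, fun z w => ?_, hfix, fun z hz => ?_⟩
  · have h1 := hπi z (π w) (hπ w)
    have h2 := hπi w (π z) (hπ z)
    have h3 : ‖π z - π w‖ ^ 2 ≤ ⟪z - w, π z - π w⟫ := by
      rw [← real_inner_self_eq_norm_sq]
      have e1 : ⟪z - π z, π w - π z⟫ = -⟪z - π z, π z - π w⟫ := by
        rw [← inner_neg_right, neg_sub]
      have e2 : z - w = (z - π z) - (w - π w) + (π z - π w) := by abel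
      rw [e2, inner_add_left, inner_sub_left (z - π z) (w - π w)]
      linarith
    have h4 := real_inner_le_norm (z - w) (π z - π w)
    rw [dist_eq_norm, dist_eq_norm]
    by_contra! hlt
    have : 0 < ‖π z - π w‖ := (norm_nonneg _).trans_lt hlt
    nlinarith
  · rw [hc.isClosed.frontier_eq]
    refine ⟨hπ z, fun hint => ?_⟩
    have hzP : z ∉ P := fun hzP => hz (hfix z hzP ▸ hint)
    obtain ⟨s, hs, hmem⟩ := exists_pos_add_smul_mem (mem_interior_iff_mem_nhds.1 hint) (z - π z)
    have := hπi z _ hmem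
    rw [add_sub_cancel_left, inner_smul_right] at this
    have h0 : ⟪z - π z, z - π z⟫ ≤ 0 := nonpos_of_mul_nonpos_right this hs
    have : z = π z := sub_eq_zero.1 (real_inner_self_nonpos.1 h0)
    exact hzP (this ▸ hπ z)

/-- Segments outside the interior of a convex body bound the intrinsic distance of its boundary. -/
theorem exists_retraction_intrinsicDist_le {P : Set E} (hP : Convex ℝ P) (hc : IsCompact P)
    (hne : P.Nonempty) :
    ∃ π : E → E, (∀ z ∈ frontier P, π z = z) ∧ (∀ z ∉ interior P, π z ∈ frontier P) ∧
      ∀ p q, (∀ t ∈ Icc (0 : ℝ) 1, AffineMap.lineMap p q t ∉ interior P) →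
        intrinsicDist (frontier P) (π p) (π q) ≤ edist p q := by
  obtain ⟨π, hlip, hfix, hfr⟩ := exists_lipschitz_retraction hP hc hne
  refine ⟨π, fun z hz => hfix z (hc.isClosed.frontier_subset hz), hfr, fun p q hpq => ?_⟩
  have hlip' : ∀ s ∈ Icc (0 : ℝ) 1, ∀ t ∈ Icc (0 : ℝ) 1,
      dist ((fun t : ℝ => π (AffineMap.lineMap p q t)) s)
        ((fun t : ℝ => π (AffineMap.lineMap p q t)) t) ≤ dist p q * dist s t := by
    intro s _ t _
    refine (hlip _ _).trans ?_
    rw [dist_lineMap_lineMap, mul_comm]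
  have hpath : IsPathIn (frontier P) (π p) (π q) fun t : ℝ => π (AffineMap.lineMap p q t) :=
    ⟨continuousOn_of_dist_le_mul dist_nonneg hlip', by simp, by simp,
      fun t ht => hfr _ (hpq t ht)⟩
  rw [edist_dist]
  exact (intrinsicDist_le_pathLength hpath).trans (pathLength_le_of_dist_le dist_nonneg hlip')

theorem lineMap_notMem_interior {P : Set E} {f : StrongDual ℝ E} {c : ℝ} {p q : E}
    (hf : ∀ z ∈ interior P, f z < c) (hp : c ≤ f p) (hq : c ≤ f q) :
    ∀ t ∈ Icc (0 : ℝ) 1, AffineMap.lineMap p q t ∉ interior P := by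
  intro t ht hmem
  have := hf _ hmem
  rw [AffineMap.lineMap_apply_module, map_add, map_smul, map_smul, smul_eq_mul, smul_eq_mul] at this
  nlinarith [ht.1, ht.2]

/-- A convex body which coincides near each of its points with a cone with apex at that point:
segments ending near the apex can be prolonged. -/
structure IsLocallyConicBody (P : Set E) : Prop where
  convex : Convex ℝ P
  isCompact : IsCompact P
  interior_nonempty : (interior P).Nonempty
  exists_prolong : ∀ x ∈ P, ∃ δ > 0, ∀ y ∈ P, dist y x < δ → ∃ ε > (0 : ℝ), y + ε • (y - x) ∈ P

theorem isLocallyConicBody_convexHull (A : Finset E)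
    (hne : (interior (convexHull ℝ (A : Set E))).Nonempty) :
    IsLocallyConicBody (convexHull ℝ (A : Set E)) := by
  classical
  refine ⟨convex_convexHull _ _, A.finite_toSet.isCompact_convexHull ℝ, hne, fun x _ => ?_⟩
  have hδ : ∀ B : Finset E, ∃ δ > 0, x ∉ convexHull ℝ (B : Set E) →
      ∀ y ∈ convexHull ℝ (B : Set E), δ ≤ dist y x := by
    intro B
    by_cases hx : x ∈ convexHull ℝ (B : Set E)
    · exact ⟨1, one_pos, fun h => absurd hx h⟩
    · have hcl : IsClosed (convexHull ℝ (B : Set E)) :=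
        (B.finite_toSet.isCompact_convexHull ℝ).isClosed
      obtain ⟨δ, hδ, h⟩ := Metric.isOpen_iff.1 hcl.isOpen_compl x hx
      exact ⟨δ, hδ, fun _ y hy => not_lt.1 fun hlt => h hlt hy⟩
  choose δ hδ0 hδ using hδ
  have hne' : A.powerset.Nonempty := ⟨∅, by simp⟩
  refine ⟨A.powerset.inf' hne' δ, (Finset.lt_inf'_iff _).2 fun B _ => hδ0 B, fun y hy hyx => ?_⟩
  obtain ⟨w, hw0, hw1, hwy⟩ := Finset.mem_convexHull'.1 hy
  set B := A.filter fun a => w a ≠ 0 with hB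
  have hBA : B ⊆ A := Finset.filter_subset _ _
  have hyB : y ∈ convexHull ℝ (B : Set E) := by
    refine Finset.mem_convexHull'.2 ⟨w, fun a ha => hw0 a (hBA ha), ?_, ?_⟩
    · rw [← hw1]; exact Finset.sum_filter_ne_zero _
    · rw [← hwy]
      refine Finset.sum_subset hBA fun a ha haB => ?_
      have : w a = 0 := by simpa [hB, ha] using haB
      simp [this]
  have hxB : x ∈ convexHull ℝ (B : Set E) := by
    by_contra hx
    exact absurd ((Finset.inf'_le _ (Finset.mem_powerset.2 hBA)).trans (hδ B hx y hyB))
      (not_le.2 hyx)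
  obtain ⟨u, hu0, hu1, hux⟩ := Finset.mem_convexHull'.1 hxB
  have hBne : B.Nonempty := by
    rw [← Finset.coe_nonempty, ← convexHull_nonempty_iff (𝕜 := ℝ)]; exact ⟨y, hyB⟩
  obtain ⟨w', hw'0, hw'1, hw'y⟩ := Finset.mem_convexHull'.1 hyB
  have hwpos : ∀ a ∈ B, 0 < w a := fun a ha =>
    (hw0 a (hBA ha)).lt_of_ne' (Finset.mem_filter.1 ha).2
  have hwB1 : ∑ a ∈ B, w a = 1 := by rw [← hw1]; exact Finset.sum_filter_ne_zero _
  have hwBy : ∑ a ∈ B, w a • a = y := by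
    rw [← hwy]
    refine Finset.sum_subset hBA fun a ha haB => ?_
    have : w a = 0 := by simpa [hB, ha] using haB
    simp [this]
  set ε := B.inf' hBne w with hε
  have hε0 : 0 < ε := (Finset.lt_inf'_iff _).2 hwpos
  refine ⟨ε, hε0, convexHull_mono (Finset.coe_subset.2 hBA) ?_⟩
  refine Finset.mem_convexHull'.2 ⟨fun a => w a + ε * (w a - u a), fun a ha => ?_, ?_, ?_⟩
  · have h1 : ε ≤ w a := Finset.inf'_le _ ha
    have h2 : u a ≤ 1 := hu1 ▸ Finset.single_le_sum hu0 ha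
    have h3 := hwpos a ha
    nlinarith
  · rw [Finset.sum_add_distrib, ← Finset.mul_sum, Finset.sum_sub_distrib, hwB1, hu1]
    ring
  · simp only [add_smul, mul_smul, sub_smul, Finset.sum_add_distrib, ← Finset.smul_sum,
      Finset.sum_sub_distrib, hwBy, hux]

theorem finrank_le_finrank_ker_inf_ker_add_two [FiniteDimensional ℝ E] (f g : StrongDual ℝ E) :
    Module.finrank ℝ E ≤
      Module.finrank ℝ ((f : E →ₗ[ℝ] ℝ).ker ⊓ (g : E →ₗ[ℝ] ℝ).ker : Submodule ℝ E) + 2 := by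
  have h1 := Submodule.finrank_sup_add_finrank_inf_eq (f : E →ₗ[ℝ] ℝ).ker (g : E →ₗ[ℝ] ℝ).ker
  have h2 := LinearMap.finrank_range_add_finrank_ker (f : E →ₗ[ℝ] ℝ)
  have h3 := LinearMap.finrank_range_add_finrank_ker (g : E →ₗ[ℝ] ℝ)
  have h4 := Submodule.finrank_le (LinearMap.range (f : E →ₗ[ℝ] ℝ))
  have h5 := Submodule.finrank_le (LinearMap.range (g : E →ₗ[ℝ] ℝ))
  have h6 := Submodule.finrank_le ((f : E →ₗ[ℝ] ℝ).ker ⊔ (g : E →ₗ[ℝ] ℝ).ker)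
  rw [Module.finrank_self] at h4 h5
  omega

namespace IsLocallyConicBody

variable {P : Set E} (hP : IsLocallyConicBody P)
include hP

theorem frontier_eq : frontier P = P \ interior P := hP.isCompact.isClosed.frontier_eq

theorem frontier_subset : frontier P ⊆ P := hP.isCompact.isClosed.frontier_subset

theorem exists_supporting_functional_through {x : E} (hx : x ∈ P) :
    ∃ δ > 0, ∀ y ∈ frontier P, dist x y < δ →
      ∃ f : StrongDual ℝ E, (∀ z ∈ interior P, f z < f x) ∧ f y = f x := by
  obtain ⟨δ, hδ, h⟩ := hP.exists_prolong x hx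
  refine ⟨δ, hδ, fun y hy hxy => ?_⟩
  rw [hP.frontier_eq] at hy
  obtain ⟨f, hf, hf'⟩ := exists_supporting_functional hP.convex hP.interior_nonempty hy.2
  obtain ⟨ε, hε, hmem⟩ := h y hy.1 (by rwa [dist_comm])
  have h1 := hf' _ hmem
  have h2 := hf' x hx
  rw [map_add, map_smul, map_sub, smul_eq_mul] at h1
  have h3 : f y = f x := by nlinarith
  exact ⟨f, h3 ▸ hf, h3⟩

theorem isGeodesicCompact_frontier [FiniteDimensional ℝ E] (hdim : 3 ≤ Module.finrank ℝ E) :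
    IsGeodesicCompact (frontier P) := by
  have hPne : P.Nonempty := hP.interior_nonempty.mono interior_subset
  obtain ⟨π, hπ, hπ', hdist⟩ := exists_retraction_intrinsicDist_le hP.convex hP.isCompact hPne
  refine ⟨hP.isCompact.of_isClosed_subset isClosed_frontier hP.frontier_subset, ?_, ?_⟩
  · intro a ha b hb
    have hai : a ∉ interior P := (hP.frontier_eq ▸ ha).2
    have hbi : b ∉ interior P := (hP.frontier_eq ▸ hb).2
    obtain ⟨f, hf, -⟩ := exists_supporting_functional hP.convex hP.interior_nonempty hai
    obtain ⟨g, hg, -⟩ := exists_supporting_functional hP.convex hP.interior_nonempty hbi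
    obtain ⟨m, hm, hm0⟩ : ∃ m ∈ (f : E →ₗ[ℝ] ℝ).ker ⊓ (g : E →ₗ[ℝ] ℝ).ker, m ≠ 0 := by
      refine Submodule.exists_mem_ne_zero_of_ne_bot fun hbot => ?_
      have h1 := finrank_le_finrank_ker_inf_ker_add_two f g
      rw [hbot, finrank_bot] at h1
      omega
    have hfm : f m = 0 := hm.1
    have hgm : g m = 0 := hm.2
    obtain ⟨C, hC⟩ := hP.isCompact.isBounded.exists_norm_le
    set R : ℝ := (‖m‖ * C + ‖m‖ * ‖a‖ + ‖m‖ * ‖b‖) / ‖m‖ ^ 2 with hR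
    have hm0' : 0 < ‖m‖ := norm_pos_iff.2 hm0
    have hRm : R * ‖m‖ ^ 2 = ‖m‖ * C + ‖m‖ * ‖a‖ + ‖m‖ * ‖b‖ :=
      div_mul_cancel₀ _ (by positivity)
    set ℓ : StrongDual ℝ E := innerSL ℝ m with hℓ
    have hℓm : ℓ m = ‖m‖ ^ 2 := by simp [hℓ]
    have hℓa : |ℓ a| ≤ ‖m‖ * ‖a‖ := abs_real_inner_le_norm m a
    have hℓb : |ℓ b| ≤ ‖m‖ * ‖b‖ := abs_real_inner_le_norm m b
    have hℓP : ∀ z ∈ interior P, ℓ z ≤ ‖m‖ * C := fun z hz =>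
      (real_inner_le_norm m z).trans (by gcongr; exact hC z (interior_subset hz))
    have hint : ∀ z ∈ interior P, ℓ z < ‖m‖ * C + 1 := fun z hz => (hℓP z hz).trans_lt (lt_add_one _)
    set R' : ℝ := R + 1 / ‖m‖ ^ 2 with hR'
    have hR'm : R' * ‖m‖ ^ 2 = ‖m‖ * C + ‖m‖ * ‖a‖ + ‖m‖ * ‖b‖ + 1 := by
      rw [hR', add_mul, hRm, div_mul_cancel₀ _ (by positivity)]
    have hna := norm_nonneg a
    have hnb := norm_nonneg b
    have s1 := hdist a (a + R' • m) (lineMap_notMem_interior hf le_rfl (by simp [hfm]))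
    have s2 := hdist (a + R' • m) (b + R' • m) (lineMap_notMem_interior hint
      (by
        rw [map_add, map_smul, smul_eq_mul, hℓm, hR'm]
        nlinarith [abs_le.1 hℓa, mul_nonneg hm0'.le hnb])
      (by
        rw [map_add, map_smul, smul_eq_mul, hℓm, hR'm]
        nlinarith [abs_le.1 hℓb, mul_nonneg hm0'.le hna]))
    have s3 := hdist (b + R' • m) b (lineMap_notMem_interior hg (by simp [hgm]) le_rfl)
    rw [hπ a ha] at s1
    rw [hπ b hb] at s3
    have t1 := intrinsicDist_triangle (frontier P) a (π (a + R' • m)) b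
    have t2 := intrinsicDist_triangle (frontier P) (π (a + R' • m)) (π (b + R' • m)) b
    refine ne_top_of_le_ne_top ?_ (t1.trans (add_le_add s1 (t2.trans (add_le_add s2 s3))))
    simp [edist_ne_top]
  · intro x hx
    obtain ⟨δ, hδ, h⟩ := hP.exists_supporting_functional_through (hP.frontier_subset hx)
    refine ⟨δ, hδ, fun y hy hxy => ?_⟩
    obtain ⟨f, hf, hfy⟩ := h y hy hxy
    have := hdist x y (lineMap_notMem_interior hf le_rfl hfy.ge)
    rwa [hπ x hx, hπ y hy] at this

end IsLocallyConicBody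

end ConvexBodies

section Lineality

variable {E : Type*} [NormedAddCommGroup E] [InnerProductSpace ℝ E]

/-- The span of the directions along which a point can be moved both ways inside `P`. -/
def linealityAt (P : Set E) (x : E) : Submodule ℝ E :=
  Submodule.span ℝ {w | ∃ t > (0 : ℝ), x + t • w ∈ P ∧ x - t • w ∈ P}

theorem exists_pos_add_sub_smul_mem {U : Set E} {x : E} (hU : U ∈ 𝓝 x) (u : E) :
    ∃ s > (0 : ℝ), x + s • u ∈ U ∧ x - s • u ∈ U := by
  have hc : ∀ u : E, Tendsto (fun s : ℝ => x + s • u) (𝓝[>] 0) (𝓝 x) := by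
    intro u
    have : Tendsto (fun s : ℝ => x + s • u) (𝓝 0) (𝓝 (x + (0 : ℝ) • u)) :=
      Continuous.tendsto (by fun_prop) 0
    rw [zero_smul, add_zero] at this
    exact this.mono_left nhdsWithin_le_nhds
  obtain ⟨s, ⟨hs, hs''⟩, hs'⟩ := ((((hc u).eventually hU).and ((hc (-u)).eventually hU)).and
    self_mem_nhdsWithin).exists
  refine ⟨s, hs', hs, ?_⟩
  rw [sub_eq_add_neg, ← smul_neg]
  exact hs''

section Convex

variable {P : Set E} (hP : Convex ℝ P)
include hP

theorem Convex.mem_linealityAt {x : E} (hx : x ∈ P) {w : E} :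
    w ∈ linealityAt P x ↔ ∃ t > (0 : ℝ), x + t • w ∈ P ∧ x - t • w ∈ P := by
  refine ⟨fun h => ?_, fun h => Submodule.subset_span h⟩
  have key : ∀ w, w ∈ linealityAt P x → ∃ t > (0 : ℝ), x + t • w ∈ P ∧ x + t • (-w) ∈ P := by
    intro w h
    induction h using Submodule.span_induction with
    | mem w h =>
      obtain ⟨t, ht, h1, h2⟩ := h
      exact ⟨t, ht, h1, by rwa [smul_neg, ← sub_eq_add_neg]⟩
    | zero => exact ⟨1, one_pos, by simpa, by simpa⟩
    | add w₁ w₂ _ _ h₁ h₂ =>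
      obtain ⟨t₁, ht₁, a₁, b₁⟩ := h₁
      obtain ⟨t₂, ht₂, a₂, b₂⟩ := h₂
      have ht : 0 < min t₁ t₂ := lt_min ht₁ ht₂
      have comb : ∀ u₁ u₂ : E, x + t₁ • u₁ ∈ P → x + t₂ • u₂ ∈ P →
          x + (min t₁ t₂ / 2) • (u₁ + u₂) ∈ P := by
        intro u₁ u₂ h₁ h₂
        have h₁ := hP.add_smul_mem_of_le hx h₁ ht.le (min_le_left _ _)
        have h₂ := hP.add_smul_mem_of_le hx h₂ ht.le (min_le_right _ _)
        have := hP h₁ h₂ (a := 1 / 2) (b := 1 / 2) (by norm_num) (by norm_num) (by norm_num)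
        convert this using 1
        module
      exact ⟨min t₁ t₂ / 2, half_pos ht, comb _ _ a₁ a₂, by rw [neg_add]; exact comb _ _ b₁ b₂⟩
    | smul c w _ h =>
      obtain ⟨t, ht, a, b⟩ := h
      rcases lt_trichotomy c 0 with hc | rfl | hc
      · have hc' := hc.ne
        refine ⟨t / -c, div_pos ht (neg_pos.2 hc), ?_, ?_⟩
        · rwa [show (t / -c) • c • w = t • -w by
            rw [smul_smul, smul_neg, ← neg_smul]; congr 1; field_simp]
        · rwa [show (t / -c) • -(c • w) = t • w by
            rw [← neg_smul, smul_smul]; congr 1; field_simp]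
      · exact ⟨1, one_pos, by simpa, by simpa⟩
      · refine ⟨t / c, div_pos ht hc, ?_, ?_⟩
        · rwa [show (t / c) • c • w = t • w by
            rw [smul_smul]; congr 1; field_simp]
        · rwa [show (t / c) • -(c • w) = t • -w by
            rw [← smul_neg, smul_smul]; congr 1; field_simp]
  obtain ⟨t, ht, h1, h2⟩ := key w h
  exact ⟨t, ht, h1, by rwa [smul_neg, ← sub_eq_add_neg] at h2⟩

theorem Convex.forall_notMem_or_of_notMem_linealityAt {x : E} (hx : x ∈ P) {w : E}
    (hw : w ∉ linealityAt P x) :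
    (∀ t > (0 : ℝ), x + t • w ∉ P) ∨ ∀ t > (0 : ℝ), x + t • (-w) ∉ P := by
  by_contra! h
  obtain ⟨⟨s, hs, h1⟩, t, ht, h2⟩ := h
  have hm : 0 < min s t := lt_min hs ht
  refine hw ((hP.mem_linealityAt hx).2 ⟨min s t, hm,
    hP.add_smul_mem_of_le hx h1 hm.le (min_le_left _ _), ?_⟩)
  have := hP.add_smul_mem_of_le hx h2 hm.le (min_le_right _ _)
  rwa [smul_neg, ← sub_eq_add_neg] at this

theorem Convex.linealityAt_le {q r : E} (hq : q ∈ P) (hr : r ∈ P) {s : ℝ} (h0 : 0 ≤ s)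
    (h1 : s < 1) : linealityAt P q ≤ linealityAt P (q + s • (r - q)) := by
  intro w hw
  obtain ⟨t, ht, ha, hb⟩ := (hP.mem_linealityAt hq).1 hw
  have hp : q + s • (r - q) ∈ P := hP.add_smul_sub_mem hq hr ⟨h0, h1.le⟩
  refine (hP.mem_linealityAt hp).2 ⟨(1 - s) * t, mul_pos (sub_pos.2 h1) ht, ?_, ?_⟩
  · convert hP.add_smul_sub_mem ha hr ⟨h0, h1.le⟩ using 1
    module
  · convert hP.add_smul_sub_mem hb hr ⟨h0, h1.le⟩ using 1
    module

theorem Convex.linealityAt_le_of_sub_mem {x a : E} (hx : x ∈ P) (ha : a ∈ P)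
    (h : a - x ∈ linealityAt P x) : linealityAt P a ≤ linealityAt P x := by
  obtain ⟨t, ht, -, hb⟩ := (hP.mem_linealityAt hx).1 h
  have := hP.linealityAt_le ha hb (s := 1 / (1 + t)) (by positivity)
    (by rw [div_lt_one (by positivity)]; linarith)
  convert this using 2
  rw [show x - t • (a - x) - a = (1 + t) • (x - a) by module, smul_smul,
    one_div_mul_cancel (by positivity), one_smul, add_sub_cancel]

theorem Convex.mem_interior_of_sub_mem {x y : E} (hx : x ∈ P) (hy : y ∈ interior P)
    (h : y - x ∈ linealityAt P x) : x ∈ interior P := by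
  obtain ⟨t, ht, -, hb⟩ := (hP.mem_linealityAt hx).1 h
  have := hP.add_smul_sub_mem_interior hb hy (t := t / (1 + t)) ⟨by positivity,
    by rw [div_le_one (by positivity)]; linarith⟩
  convert this using 1
  rw [show y - (x - t • (y - x)) = (1 + t) • (y - x) by module, smul_smul,
    div_mul_cancel₀ _ (by positivity)]
  module

theorem Convex.linealityAt_eq_top {x : E} (hx : x ∈ interior P) : linealityAt P x = ⊤ := by
  refine eq_top_iff.2 fun w _ => ?_
  exact (hP.mem_linealityAt (interior_subset hx)).2
    (exists_pos_add_sub_smul_mem (mem_interior_iff_mem_nhds.1 hx) w)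

theorem Convex.notMem_interior_of_finrank_lt [FiniteDimensional ℝ E] {x : E}
    (h : Module.finrank ℝ (linealityAt P x) < Module.finrank ℝ E) : x ∉ interior P := by
  intro hx
  rw [hP.linealityAt_eq_top hx, finrank_top] at h
  exact lt_irrefl _ h

variable {x y : E} (hx : x ∈ P) (hy : y ∈ P) {ε : ℝ} (hε : 0 < ε) (h : y + ε • (y - x) ∈ P)
include hx h hε

theorem Convex.linealityAt_le_of_prolong : linealityAt P x ≤ linealityAt P y := by
  have := hP.linealityAt_le hx h (s := 1 / (1 + ε)) (by positivity)
    (by rw [div_lt_one (by positivity)]; linarith)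
  convert this using 2
  rw [show y + ε • (y - x) - x = (1 + ε) • (y - x) by module, smul_smul,
    one_div_mul_cancel (by positivity), one_smul, add_sub_cancel]

include hy

theorem Convex.sub_mem_linealityAt_of_prolong : y - x ∈ linealityAt P y := by
  refine (hP.mem_linealityAt hy).2 ⟨min 1 ε, lt_min one_pos hε,
    hP.add_smul_mem_of_le hy h (by positivity) (min_le_right _ _), ?_⟩
  have := hP.add_smul_mem_of_le (s := min 1 ε) hy (w := x - y) (t := 1) (by simpa) (by positivity)
    (min_le_left _ _)
  convert this using 1
  module

theorem Convex.linealityAt_add_smul_eq_of_prolong {s : ℝ} (h0 : 0 < s) (h1 : s ≤ 1) :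
    linealityAt P (x + s • (y - x)) = linealityAt P y := by
  have hy' : x + s • (y - x) ∈ P := hP.add_smul_sub_mem hx hy ⟨h0.le, h1⟩
  apply le_antisymm
  · have := hP.linealityAt_le hy' h (s := (1 - s) / (1 + ε - s))
      (div_nonneg (by linarith) (by linarith))
      (by rw [div_lt_one (by linarith)]; linarith)
    convert this using 2
    rw [show y + ε • (y - x) - (x + s • (y - x)) = (1 + ε - s) • (y - x) by module, smul_smul,
      div_mul_cancel₀ _ (by linarith)]
    module
  · have := hP.linealityAt_le hy hx (s := 1 - s) (by linarith) (by linarith)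
    convert this using 2
    module

end Convex

namespace IsLocallyConicBody

variable {P : Set E} (hP : IsLocallyConicBody P)
include hP

/-- The complement of the tangent cone is open. -/
theorem exists_forall_notMem_of_forall_notMem {x N : E} (hx : x ∈ P)
    (hN : ∀ t > (0 : ℝ), x + t • N ∉ P) :
    ∃ ε > 0, ∀ w : E, ‖w‖ ≤ ε → ∀ t > (0 : ℝ), x + t • (N + w) ∉ P := by
  obtain ⟨δ, hδ, hprol⟩ := hP.exists_prolong x hx
  set c : ℝ := δ / (‖N‖ + 2) with hc
  have hc0 : 0 < c := by positivity
  have hcδ : c * (‖N‖ + 2) = δ := div_mul_cancel₀ _ (by positivity)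
  have hev : ∀ᶠ w in 𝓝 (0 : E), x + c • (N + w) ∉ P := by
    have : Tendsto (fun w : E => x + c • (N + w)) (𝓝 0) (𝓝 (x + c • (N + 0))) :=
      Continuous.tendsto (by fun_prop) 0
    rw [add_zero] at this
    exact this.eventually (hP.isCompact.isClosed.isOpen_compl.mem_nhds (hN c hc0))
  obtain ⟨ε, hε, hball⟩ := Metric.eventually_nhds_iff.1 hev
  refine ⟨min 1 (ε / 2), by positivity, fun w hw t ht hmem => ?_⟩
  have hw1 : ‖w‖ ≤ 1 := hw.trans (min_le_left _ _)
  have hcw : x + c • (N + w) ∉ P := hball (by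
    rw [dist_zero_right]; exact (hw.trans (min_le_right _ _)).trans_lt (half_lt_self hε))
  set u := N + w with hu
  have hu2 : ‖u‖ < ‖N‖ + 2 := (norm_add_le _ _).trans_lt (by linarith)
  have htc : t < c := by
    by_contra! hct
    exact hcw (hP.convex.add_smul_mem_of_le hx hmem hc0.le hct)
  have hcomp : IsCompact (Icc 0 c ∩ (fun t : ℝ => x + t • u) ⁻¹' P) :=
    isCompact_Icc.inter_right (hP.isCompact.isClosed.preimage (by fun_prop))
  obtain ⟨s, ⟨hs, hsP⟩, hmax⟩ := hcomp.exists_isGreatest ⟨t, ⟨ht.le, htc.le⟩, hmem⟩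
  have hsc : s < c := lt_of_le_of_ne hs.2 fun h => hcw (h ▸ hsP)
  have hst : t ≤ s := hmax ⟨⟨ht.le, htc.le⟩, hmem⟩
  have hs0 : 0 < s := ht.trans_le hst
  obtain ⟨η, hη, hp⟩ := hprol (x + s • u) hsP (by
    rw [dist_eq_norm, add_sub_cancel_left, norm_smul, Real.norm_of_nonneg hs0.le, ← hcδ]
    exact mul_lt_mul'' hsc hu2 hs0.le (norm_nonneg _))
  have hp' : x + (s + η * s) • u ∈ P := by
    convert hp using 1
    module
  have hlt : s < min c (s + η * s) := lt_min hsc (by nlinarith)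
  exact absurd (hmax ⟨⟨(hs0.trans hlt).le, min_le_left _ _⟩,
    hP.convex.add_smul_mem_of_le hx hp' (hs0.trans hlt).le (min_le_right _ _)⟩) (not_le.2 hlt)

variable [FiniteDimensional ℝ E]

theorem exists_finrank_linealityAt_eq_succ {x : E} (hx : x ∈ P) (hxi : x ∉ interior P) {ε : ℝ}
    (hε : 0 < ε) :
    ∃ y ∈ P, dist y x < ε ∧
      Module.finrank ℝ (linealityAt P y) = Module.finrank ℝ (linealityAt P x) + 1 := by
  classical
  obtain ⟨δ, hδ, hprol⟩ := hP.exists_prolong x hx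
  set η := min δ ε with hη
  have hη0 : 0 < η := lt_min hδ hε
  have hex : ∃ m, ∃ y ∈ P, dist y x < η ∧ y - x ∉ linealityAt P x ∧
      Module.finrank ℝ (linealityAt P y) = m := by
    have hcl : x ∈ closure (interior P) := by
      rw [hP.convex.closure_interior_eq_closure_of_nonempty_interior hP.interior_nonempty]
      exact subset_closure hx
    obtain ⟨y, hy, hyx⟩ := Metric.mem_closure_iff.1 hcl η hη0
    exact ⟨_, y, interior_subset hy, by rwa [dist_comm],
      fun h => hxi (hP.convex.mem_interior_of_sub_mem hx hy h), rfl⟩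
  obtain ⟨y, hy, hyx, hyL, hrank⟩ := Nat.find_spec hex
  obtain ⟨τ, hτ, hyτ⟩ := hprol y hy (hyx.trans_le (min_le_left _ _))
  have hle : linealityAt P x ≤ linealityAt P y := hP.convex.linealityAt_le_of_prolong hx hτ hyτ
  have hmem : y - x ∈ linealityAt P y := hP.convex.sub_mem_linealityAt_of_prolong hx hy hτ hyτ
  set M := linealityAt P x ⊔ Submodule.span ℝ {y - x} with hM
  have hML : M ≤ linealityAt P y :=
    sup_le hle ((Submodule.span_singleton_le_iff_mem _ _).2 hmem)
  have hMrank : Module.finrank ℝ M = Module.finrank ℝ (linealityAt P x) + 1 :=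
    Submodule.finrank_sup_span_singleton hyL
  refine ⟨y, hy, hyx.trans_le (min_le_right _ _), ?_⟩
  by_contra hne
  have hlt : M < linealityAt P y := lt_of_le_of_ne hML fun h => hne (h ▸ hMrank)
  obtain ⟨N, hNy, hNM, hNx⟩ : ∃ N ∈ linealityAt P y, N ∉ M ∧ ∀ t > (0 : ℝ), x + t • N ∉ P := by
    obtain ⟨N, hNy, hNM⟩ := SetLike.exists_of_lt hlt
    rcases hP.convex.forall_notMem_or_of_notMem_linealityAt hx
      (fun h => hNM (le_sup_left (a := linealityAt P x) h)) with h | h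
    · exact ⟨N, hNy, hNM, h⟩
    · exact ⟨-N, neg_mem hNy, fun h => hNM (neg_mem_iff.1 h), h⟩
  set c : ℝ := η / (2 * (‖N‖ + 1)) with hc
  have hc0 : 0 < c := by positivity
  have hcη : c * (‖N‖ + 1) = η / 2 := by rw [hc]; field_simp
  have hev : ∀ᶠ s in 𝓝[>] (0 : ℝ), x + s • (y - x) + c • N ∉ P := by
    have : Tendsto (fun s : ℝ => x + s • (y - x) + c • N) (𝓝 0)
        (𝓝 (x + (0 : ℝ) • (y - x) + c • N)) := Continuous.tendsto (by fun_prop) 0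
    rw [zero_smul, add_zero] at this
    exact (this.mono_left nhdsWithin_le_nhds).eventually
      (hP.isCompact.isClosed.isOpen_compl.mem_nhds (hNx c hc0))
  obtain ⟨s, hsP, hs0, hs1⟩ := (hev.and (Ioc_mem_nhdsGT (show (0 : ℝ) < 1 / 2 by norm_num))).exists
  set p := x + s • (y - x) with hp
  have hpP : p ∈ P := hP.convex.add_smul_sub_mem hx hy ⟨hs0.le, by linarith⟩
  have hpL : linealityAt P p = linealityAt P y :=
    hP.convex.linealityAt_add_smul_eq_of_prolong hx hy hτ hyτ hs0 (by linarith)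
  have hcomp : IsCompact (Icc 0 c ∩ (fun t : ℝ => p + t • N) ⁻¹' P) :=
    isCompact_Icc.inter_right (hP.isCompact.isClosed.preimage (by fun_prop))
  obtain ⟨t, ⟨ht, htP⟩, hmax⟩ := hcomp.exists_isGreatest
    ⟨0, ⟨le_rfl, hc0.le⟩, by simpa using hpP⟩
  have htc : t < c := lt_of_le_of_ne ht.2 fun h => hsP (h ▸ htP)
  have hqL : linealityAt P (p + t • N) < linealityAt P y := by
    refine lt_of_le_of_ne ?_ fun heq => ?_
    · rw [← hpL]
      refine hP.convex.linealityAt_le_of_sub_mem hpP htP ?_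
      rw [add_sub_cancel_left, hpL]
      exact Submodule.smul_mem _ _ hNy
    · obtain ⟨σ, hσ, h1, -⟩ := (hP.convex.mem_linealityAt htP).1 (heq ▸ hNy)
      have h1' : p + (t + σ) • N ∈ P := by
        convert h1 using 1
        module
      have hlt : t < min c (t + σ) := lt_min htc (by linarith)
      have h0' := (ht.1.trans_lt hlt).le
      exact absurd (hmax ⟨⟨h0', min_le_left _ _⟩,
        hP.convex.add_smul_mem_of_le hpP h1' h0' (min_le_right _ _)⟩) (not_le.2 hlt)
  have hfr := Submodule.finrank_lt_finrank_of_lt hqL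
  rw [hrank] at hfr
  refine Nat.find_min hex hfr ⟨p + t • N, htP, ?_, fun hmemx => ?_, rfl⟩
  · have e : p + t • N - x = s • (y - x) + t • N := by rw [hp]; abel
    rw [dist_eq_norm] at hyx ⊢
    rw [e]
    refine (norm_add_le _ _).trans_lt ?_
    rw [norm_smul, norm_smul, Real.norm_of_nonneg hs0.le, Real.norm_of_nonneg ht.1]
    have h1 : t * ‖N‖ ≤ c * ‖N‖ := by gcongr
    nlinarith [norm_nonneg (y - x), norm_nonneg N]
  · have e : p + t • N - x = s • (y - x) + t • N := by rw [hp]; abel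
    rw [e] at hmemx
    rcases ht.1.eq_or_lt with rfl | ht0
    · rw [zero_smul, add_zero] at hmemx
      exact hyL ((Submodule.smul_mem_iff _ hs0.ne').1 hmemx)
    · refine hNM ((Submodule.smul_mem_iff _ ht0.ne').1 ?_)
      rw [show t • N = (s • (y - x) + t • N) - s • (y - x) by abel]
      exact sub_mem (le_sup_left (a := linealityAt P x) hmemx)
        (Submodule.smul_mem _ _ (le_sup_right (a := linealityAt P x)
          (Submodule.mem_span_singleton_self _)))

theorem exists_finrank_linealityAt_eq_add {x : E} (hx : x ∈ P) (j : ℕ)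
    (hj : Module.finrank ℝ (linealityAt P x) + j ≤ Module.finrank ℝ E) {ε : ℝ} (hε : 0 < ε) :
    ∃ y ∈ P, dist y x < ε ∧
      Module.finrank ℝ (linealityAt P y) = Module.finrank ℝ (linealityAt P x) + j := by
  induction j generalizing ε with
  | zero => exact ⟨x, hx, by simpa, rfl⟩
  | succ j ih =>
    obtain ⟨y, hy, hyx, hr⟩ := ih (by omega) (half_pos hε)
    obtain ⟨z, hz, hzy, hr'⟩ := hP.exists_finrank_linealityAt_eq_succ hy
      (hP.convex.notMem_interior_of_finrank_lt (by omega)) (half_pos hε)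
    exact ⟨z, hz, (dist_triangle z y x).trans_lt (by linarith), by omega⟩

theorem isClosed_setOf_finrank_linealityAt_le (m : ℕ) :
    IsClosed {x | x ∈ P ∧ Module.finrank ℝ (linealityAt P x) ≤ m} := by
  refine isClosed_of_closure_subset fun x hx => ?_
  have hxP : x ∈ P := closure_minimal (fun y hy => hy.1) hP.isCompact.isClosed hx
  obtain ⟨δ, hδ, hprol⟩ := hP.exists_prolong x hxP
  obtain ⟨y, hy, hyx⟩ := Metric.mem_closure_iff.1 hx δ hδ
  obtain ⟨τ, hτ, hyτ⟩ := hprol y hy.1 (by rwa [dist_comm])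
  exact ⟨hxP, (Submodule.finrank_mono
    (hP.convex.linealityAt_le_of_prolong hxP hτ hyτ)).trans hy.2⟩

end IsLocallyConicBody

section Faces

variable {P F : Set E}

theorem IsFace.linealityAt_le_direction (hF : IsFace P F) (hP : Convex ℝ P) {x : E} (hx : x ∈ F) :
    linealityAt P x ≤ (affineSpan ℝ F).direction := by
  intro w hw
  have hxP : x ∈ P := hF.2.2.1 hx
  obtain ⟨t, ht, h1, h2⟩ := (hP.mem_linealityAt hxP).1 hw
  have hseg : x ∈ openSegment ℝ (x + t • w) (x - t • w) :=
    ⟨1 / 2, 1 / 2, by norm_num, by norm_num, by norm_num, by module⟩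
  have h3 : x + t • w ∈ F := hF.2.2.left_mem_of_mem_openSegment h1 h2 hx hseg
  have := AffineSubspace.vsub_mem_direction (subset_affineSpan ℝ F h3) (subset_affineSpan ℝ F hx)
  rw [vsub_eq_sub, add_sub_cancel_left] at this
  exact (Submodule.smul_mem_iff _ ht.ne').1 this

theorem direction_le_linealityAt (hFP : F ⊆ P) {v : E} (hv : v ∈ intrinsicInterior ℝ F) :
    (affineSpan ℝ F).direction ≤ linealityAt P v := by
  intro w hw
  have hvF : v ∈ affineSpan ℝ F := subset_affineSpan ℝ F (intrinsicInterior_subset hv)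
  obtain ⟨y, hy, rfl⟩ := mem_intrinsicInterior.1 hv
  obtain ⟨u, hu, hsub⟩ := mem_nhds_subtype _ _ _ |>.1 (mem_interior_iff_mem_nhds.1 hy)
  obtain ⟨t, ht, h1, h2⟩ := exists_pos_add_sub_smul_mem hu w
  refine Submodule.subset_span ⟨t, ht, hFP ?_, hFP ?_⟩
  · refine @hsub ⟨_, ?_⟩ h1
    rw [add_comm]
    exact AffineSubspace.vadd_mem_of_mem_direction (Submodule.smul_mem _ _ hw) hvF
  · refine @hsub ⟨_, ?_⟩ h2
    rw [sub_eq_neg_add]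
    exact AffineSubspace.vadd_mem_of_mem_direction (neg_mem (Submodule.smul_mem _ _ hw)) hvF

end Faces

end Lineality

section Shortcut

variable {E : Type*} [NormedAddCommGroup E] [InnerProductSpace ℝ E]

theorem norm_sub_le_sub_inner_div {u w : E} (hu : u ≠ 0) :
    ‖u - w‖ ≤ ‖u‖ - ⟪u, w⟫ / ‖u‖ + ‖w‖ ^ 2 / (2 * ‖u‖) := by
  have hu' : 0 < ‖u‖ := norm_pos_iff.2 hu
  have h := norm_sub_sq_real u w
  have e : ‖u‖ - ⟪u, w⟫ / ‖u‖ + ‖w‖ ^ 2 / (2 * ‖u‖) = (‖u - w‖ ^ 2 + ‖u‖ ^ 2) / (2 * ‖u‖) := by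
    rw [h]
    field_simp
    ring
  rw [e, le_div_iff₀ (by positivity)]
  nlinarith [sq_nonneg (‖u - w‖ - ‖u‖)]

theorem exists_pos_norm_add_norm_add_norm_lt {u w p q : E} (hu : u ≠ 0) (hw : w ≠ 0)
    (h : ‖p - q‖ < ⟪u, p⟫ / ‖u‖ + ⟪w, q⟫ / ‖w‖) :
    ∃ t > (0 : ℝ), ‖u - t • p‖ + ‖t • p - t • q‖ + ‖w - t • q‖ < ‖u‖ + ‖w‖ := by
  set κ := ⟪u, p⟫ / ‖u‖ + ⟪w, q⟫ / ‖w‖ - ‖p - q‖ with hκ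
  have hκ0 : 0 < κ := sub_pos.2 h
  set C := ‖p‖ ^ 2 / (2 * ‖u‖) + ‖q‖ ^ 2 / (2 * ‖w‖) with hC
  have hC0 : 0 ≤ C := by positivity
  set t := κ / (C + 1) with ht
  have ht0 : 0 < t := by positivity
  have htC : t * (C + 1) = κ := div_mul_cancel₀ _ (by positivity)
  refine ⟨t, ht0, ?_⟩
  have h1 := norm_sub_le_sub_inner_div (w := t • p) hu
  have h2 := norm_sub_le_sub_inner_div (w := t • q) hw
  rw [inner_smul_right, norm_smul, Real.norm_of_nonneg ht0.le, mul_pow, mul_div_assoc,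
    mul_div_assoc] at h1 h2
  rw [← smul_sub, norm_smul, Real.norm_of_nonneg ht0.le]
  have e : t * (C + 1) * t = t * (⟪u, p⟫ / ‖u‖ + ⟪w, q⟫ / ‖w‖ - ‖p - q‖) := by rw [htC]; ring
  rw [hC] at e
  nlinarith [mul_pos ht0 ht0]

theorem norm_inv_smul_sub_lt_two {u w : E} (hu : u ≠ 0) (hw : w ≠ 0)
    (h : ‖u‖⁻¹ • u ≠ -(‖w‖⁻¹ • w)) : ‖‖u‖⁻¹ • u - ‖w‖⁻¹ • w‖ < 2 := by
  have hu1 : ‖‖u‖⁻¹ • u‖ = 1 := norm_smul_inv_norm (𝕜 := ℝ) hu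
  have hw1 : ‖‖w‖⁻¹ • w‖ = 1 := norm_smul_inv_norm (𝕜 := ℝ) hw
  have hle := norm_sub_le (‖u‖⁻¹ • u) (‖w‖⁻¹ • w)
  rw [hu1, hw1] at hle
  refine lt_of_le_of_ne (by linarith) fun heq => h ?_
  have hp := parallelogram_law_with_norm ℝ (‖u‖⁻¹ • u) (‖w‖⁻¹ • w)
  rw [heq, hu1, hw1] at hp
  have : ‖‖u‖⁻¹ • u + ‖w‖⁻¹ • w‖ = 0 := by nlinarith [norm_nonneg (‖u‖⁻¹ • u + ‖w‖⁻¹ • w)]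
  exact eq_neg_of_add_eq_zero_left (norm_eq_zero.1 this)

namespace IsLocallyConicBody

variable {P : Set E} (hP : IsLocallyConicBody P)
include hP

theorem surfDist_lt_of_detour {x a b p q : E} (ha : a ∈ frontier P) (hb : b ∈ frontier P)
    {f g : StrongDual ℝ E} (hf : ∀ z ∈ interior P, f z < f x) (hfa : f a = f x)
    (hg : ∀ z ∈ interior P, g z < g x) (hgb : g b = g x) (hax : a - x ≠ 0) (hbx : b - x ≠ 0)
    (hfp : f p = 0) (hgq : g q = 0)
    (hpq : ∀ t > (0 : ℝ), ∀ s ∈ Icc (0 : ℝ) 1, x + t • (AffineMap.lineMap p q s) ∉ interior P)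
    (h : ‖p - q‖ < ⟪a - x, p⟫ / ‖a - x‖ + ⟪b - x, q⟫ / ‖b - x‖) :
    surfDist (frontier P) a b < dist a x + dist x b := by
  obtain ⟨π, hπ, -, hdist⟩ := exists_retraction_intrinsicDist_le hP.convex hP.isCompact
    (hP.interior_nonempty.mono interior_subset)
  obtain ⟨t, ht, hlt⟩ := exists_pos_norm_add_norm_add_norm_lt hax hbx h
  have s1 := hdist a (x + t • p) (lineMap_notMem_interior hf hfa.ge (by simp [hfp]))
  have s2 := hdist (x + t • p) (x + t • q) (by
    intro s hs
    convert hpq t ht s hs using 2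
    rw [AffineMap.lineMap_apply_module, AffineMap.lineMap_apply_module]
    module)
  have s3 := hdist (x + t • q) b (lineMap_notMem_interior hg (by simp [hgq]) hgb.ge)
  rw [hπ a ha] at s1
  rw [hπ b hb] at s3
  have t1 := intrinsicDist_triangle (frontier P) a (π (x + t • p)) b
  have t2 := intrinsicDist_triangle (frontier P) (π (x + t • p)) (π (x + t • q)) b
  have hle := t1.trans (add_le_add s1 (t2.trans (add_le_add s2 s3)))
  have hle' := ENNReal.toReal_mono (by simp [edist_ne_top]) hle
  rw [ENNReal.toReal_add (by simp [edist_ne_top]) (by simp [edist_ne_top]),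
    ENNReal.toReal_add (by simp [edist_ne_top]) (by simp [edist_ne_top]),
    ← dist_edist, ← dist_edist, ← dist_edist] at hle'
  rw [surfDist]
  refine hle'.trans_lt ?_
  rw [dist_eq_norm a x, dist_comm x b, dist_eq_norm b x, dist_comm _ b, dist_eq_norm, dist_eq_norm,
    dist_eq_norm, add_sub_add_left_eq_sub, ← sub_sub a, ← sub_sub b]
  linarith

variable [FiniteDimensional ℝ E]

/-- Near a point where the body is conic with a lineality space of codimension at least `3`, it is
never shortest to pass through that point. -/
theorem exists_surfDist_lt_add {x : E} (hx : x ∈ P)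
    (hdim : Module.finrank ℝ (linealityAt P x) + 3 ≤ Module.finrank ℝ E) :
    ∃ δ > 0, ∀ a ∈ frontier P, ∀ b ∈ frontier P, dist x a < δ → dist x b < δ →
      a - x ∉ linealityAt P x → b ≠ x →
      surfDist (frontier P) a b < dist a x + dist x b := by
  obtain ⟨δ, hδ, hsupp⟩ := hP.exists_supporting_functional_through hx
  refine ⟨δ, hδ, fun a ha b hb hxa hxb haL hbx => ?_⟩
  obtain ⟨f, hf, hfa⟩ := hsupp a ha hxa
  obtain ⟨g, hg, hgb⟩ := hsupp b hb hxb
  have hu : a - x ≠ 0 := fun h => haL (h ▸ zero_mem _)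
  have hw : b - x ≠ 0 := sub_ne_zero.2 hbx
  have hfu : f (a - x) = 0 := by rw [map_sub, hfa, sub_self]
  have hgw : g (b - x) = 0 := by rw [map_sub, hgb, sub_self]
  obtain ⟨N, hN, hNL⟩ : ∃ N ∈ (f : E →ₗ[ℝ] ℝ).ker ⊓ (g : E →ₗ[ℝ] ℝ).ker,
      N ∉ linealityAt P x := by
    refine SetLike.not_le_iff_exists.1 fun hle => ?_
    have h1 := Submodule.finrank_mono hle
    have h2 := finrank_le_finrank_ker_inf_ker_add_two f g
    omega
  have hfN : f N = 0 := hN.1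
  have hgN : g N = 0 := hN.2
  have hxf : ∀ t : ℝ, ∀ m, f m = 0 → x + t • m ∉ interior P := fun t m hm h => by
    simpa [hm] using hf _ h
  have case1 : ∀ m, f m = 0 → g m = 0 → 0 < ⟪a - x, m⟫ / ‖a - x‖ + ⟪b - x, m⟫ / ‖b - x‖ →
      surfDist (frontier P) a b < dist a x + dist x b := by
    intro m hfm hgm hpos
    refine hP.surfDist_lt_of_detour (p := m) (q := m) ha hb hf hfa hg hgb hu hw hfm hgm ?_
      (by rwa [sub_self, norm_zero])
    intro t _ s _
    rw [AffineMap.lineMap_same_apply]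
    exact hxf t m hfm
  have case2 : ∀ m, f m = 0 → g m = 0 → ⟪a - x, m⟫ / ‖a - x‖ + ⟪b - x, m⟫ / ‖b - x‖ = 0 →
      (∀ t > (0 : ℝ), x + t • m ∉ P) → surfDist (frontier P) a b < dist a x + dist x b := by
    intro m hfm hgm hzero hmP
    obtain ⟨ε, hε, hcone⟩ := hP.exists_forall_notMem_of_forall_notMem hx hmP
    have hu1 : ‖‖a - x‖⁻¹ • (a - x)‖ = 1 := norm_smul_inv_norm (𝕜 := ℝ) hu
    have hw1 : ‖‖b - x‖⁻¹ • (b - x)‖ = 1 := norm_smul_inv_norm (𝕜 := ℝ) hw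
    have hu0 : 0 < ‖a - x‖ := norm_pos_iff.2 hu
    have hw0 : 0 < ‖b - x‖ := norm_pos_iff.2 hw
    have hne : ‖a - x‖⁻¹ • (a - x) ≠ -(‖b - x‖⁻¹ • (b - x)) := by
      intro heq
      have haP := hP.frontier_subset ha
      have hbP := hP.frontier_subset hb
      rcases hP.convex.forall_notMem_or_of_notMem_linealityAt hx haL with h | h
      · exact h 1 one_pos (by simpa using haP)
      · refine h (‖b - x‖ * ‖a - x‖⁻¹) (by positivity) ?_
        rw [smul_neg, mul_smul, heq, smul_neg, neg_neg, smul_smul, mul_inv_cancel₀ hw0.ne', one_smul,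
          add_sub_cancel]
        exact hbP
    have h2 := norm_inv_smul_sub_lt_two hu hw hne
    refine hP.surfDist_lt_of_detour (p := m + ε • (‖a - x‖⁻¹ • (a - x)))
      (q := m + ε • (‖b - x‖⁻¹ • (b - x))) ha hb hf hfa hg hgb hu hw
      (by rw [map_add, map_smul, map_smul, hfm, hfu]; simp)
      (by rw [map_add, map_smul, map_smul, hgm, hgw]; simp) ?_ ?_
    · intro t ht s hs hmem
      refine hcone (ε • AffineMap.lineMap (‖a - x‖⁻¹ • (a - x)) (‖b - x‖⁻¹ • (b - x)) s) ?_ t ht ?_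
      · rw [norm_smul, Real.norm_of_nonneg hε.le]
        refine mul_le_of_le_one_right hε.le ?_
        rw [AffineMap.lineMap_apply_module]
        refine (norm_add_le _ _).trans ?_
        rw [norm_smul (1 - s), norm_smul s, hu1, hw1, Real.norm_of_nonneg hs.1,
          Real.norm_of_nonneg (sub_nonneg.2 hs.2)]
        linarith
      · convert interior_subset hmem using 2
        rw [AffineMap.lineMap_apply_module, AffineMap.lineMap_apply_module]
        module
    · rw [add_sub_add_left_eq_sub, ← smul_sub, norm_smul, Real.norm_of_nonneg hε.le,
        inner_add_right, inner_add_right, inner_smul_right, inner_smul_right, inner_smul_right,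
        inner_smul_right, real_inner_self_eq_norm_sq, real_inner_self_eq_norm_sq, add_div, add_div]
      have e1 : ε * (‖a - x‖⁻¹ * ‖a - x‖ ^ 2) / ‖a - x‖ = ε := by field_simp
      have e2 : ε * (‖b - x‖⁻¹ * ‖b - x‖ ^ 2) / ‖b - x‖ = ε := by field_simp
      rw [e1, e2]
      nlinarith
  have hneg : ∀ m : E, ⟪a - x, -m⟫ / ‖a - x‖ + ⟪b - x, -m⟫ / ‖b - x‖ =
      -(⟪a - x, m⟫ / ‖a - x‖ + ⟪b - x, m⟫ / ‖b - x‖) := by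
    intro m
    rw [inner_neg_right, inner_neg_right]
    ring
  rcases lt_trichotomy (⟪a - x, N⟫ / ‖a - x‖ + ⟪b - x, N⟫ / ‖b - x‖) 0 with h | h | h
  · exact case1 (-N) (by simpa) (by simpa) (by rw [hneg]; linarith)
  · rcases hP.convex.forall_notMem_or_of_notMem_linealityAt hx hNL with h' | h'
    · exact case2 N hfN hgN h h'
    · exact case2 (-N) (by simpa) (by simpa) (by rw [hneg, h, neg_zero]) h'
  · exact case1 N hfN hgN h

end IsLocallyConicBody

end Shortcut

section WarpedPoints

variable {E : Type*} [NormedAddCommGroup E] [InnerProductSpace ℝ E] [FiniteDimensional ℝ E]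
  {P : Set E}

/-- Points at which the lineality space has codimension at least `3`. -/
def warpedSet (P : Set E) : Set E :=
  {x | x ∈ P ∧ Module.finrank ℝ (linealityAt P x) + 3 ≤ Module.finrank ℝ E}

namespace IsLocallyConicBody

variable (hP : IsLocallyConicBody P)
include hP

theorem isClosed_warpedSet : IsClosed (warpedSet P) := by
  rcases le_or_gt 3 (Module.finrank ℝ E) with h | h
  · convert hP.isClosed_setOf_finrank_linealityAt_le (Module.finrank ℝ E - 3) using 1
    ext x
    exact and_congr_right fun _ => by omega
  · convert isClosed_empty
    ext x
    simp only [warpedSet, mem_ofPred_eq, mem_empty_iff_false, iff_false]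
    omega

theorem warpedSet_subset_frontier : warpedSet P ⊆ frontier P := fun x hx => by
  rw [hP.frontier_eq]
  exact ⟨hx.1, hP.convex.notMem_interior_of_finrank_lt (by have := hx.2; omega)⟩

/-- A shortest path from an unwarped point does not pass through a warped point. -/
theorem surfDist_ne_add_of_mem_warpedSet {v y z : E} (hv : v ∈ frontier P) (hvW : v ∉ warpedSet P)
    (hy : y ∈ frontier P) (hz : z ∈ warpedSet P) (hzy : z ≠ y) :
    surfDist (frontier P) v z + surfDist (frontier P) z y ≠ surfDist (frontier P) v y := by
  intro heq
  have hS := hP.isGeodesicCompact_frontier (by have := hz.2; omega)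
  set μ := surfDist (frontier P) with hμ
  have hWS := hP.warpedSet_subset_frontier
  have hcont : ContinuousOn (fun z => μ v z) (frontier P) := hS.continuousOn_surfDist hv
  have hcont' : ContinuousOn (fun z => μ v z + μ z y) (frontier P) := by
    refine hcont.add ?_
    simp_rw [hμ, surfDist_comm _ _ y]
    exact hS.continuousOn_surfDist hy
  have hcomp : IsCompact (warpedSet P ∩ (fun z => μ v z + μ z y) ⁻¹' {μ v y}) := by
    refine hS.isCompact.of_isClosed_subset ?_ fun z hz => hWS hz.1
    exact (hcont'.mono hWS).preimage_isClosed_of_isClosed hP.isClosed_warpedSet isClosed_singleton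
  obtain ⟨x, ⟨hxW, hxeq⟩, hmin⟩ := hcomp.exists_isMinOn ⟨z, hz, heq⟩
    (hcont.mono fun z hz => hWS hz.1)
  have hxeq : μ v x + μ x y = μ v y := hxeq
  have hxS := hWS hxW
  have hxz : μ v x ≤ μ v z := hmin ⟨hz, heq⟩
  have hzy0 : 0 < μ z y := (surfDist_nonneg _ _ _).lt_of_ne' fun h =>
    hzy (hS.eq_of_surfDist_eq_zero (hWS hz) hy h)
  have hxy0 : 0 < μ x y := by linarith
  have hvx0 : 0 < μ v x := (surfDist_nonneg _ _ _).lt_of_ne' fun h =>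
    hvW (hS.eq_of_surfDist_eq_zero hv hxS h ▸ hxW)
  obtain ⟨δ, hδ, hshort⟩ := hP.exists_surfDist_lt_add hxW.1 hxW.2
  obtain ⟨δ', hδ', hloc⟩ := hS.exists_surfDist_eq_dist hxS
  have hm : 0 < min δ δ' := lt_min hδ hδ'
  obtain ⟨t, ht0, ht1, htv, hty⟩ : ∃ t > (0 : ℝ), t < 1 ∧ t * μ v x < min δ δ' ∧
      t * μ x y < min δ δ' := by
    have h : ∀ c : ℝ, ∀ᶠ t in 𝓝[>] (0 : ℝ), t * c < min δ δ' := fun c => by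
      have : Tendsto (fun t : ℝ => t * c) (𝓝 0) (𝓝 (0 * c)) := Continuous.tendsto (by fun_prop) 0
      rw [zero_mul] at this
      exact (this.mono_left nhdsWithin_le_nhds).eventually (gt_mem_nhds hm)
    obtain ⟨t, ⟨h1, h2⟩, h3, h4⟩ := (((h (μ v x)).and (h (μ x y))).and
      (Ioo_mem_nhdsGT one_pos)).exists
    exact ⟨t, h3, h4, h1, h2⟩
  obtain ⟨a, haS, ha1, ha2⟩ := hS.exists_between hv hxS (t := 1 - t) ⟨by linarith, by linarith⟩
  obtain ⟨b, hbS, hb1, hb2⟩ := hS.exists_between hxS hy (t := t) ⟨ht0.le, ht1.le⟩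
  rw [← hμ] at ha1 ha2 hb1 hb2
  rw [sub_sub_cancel] at ha2
  have tri : μ v y ≤ μ v a + (μ a b + μ b y) :=
    (hS.surfDist_triangle hv haS hy).trans (by gcongr; exact hS.surfDist_triangle haS hbS hy)
  have tri2 : μ a y ≤ μ a x + μ x y := hS.surfDist_triangle haS hxS hy
  have tri3 : μ v y ≤ μ v a + μ a y := hS.surfDist_triangle hv haS hy
  have hxa : dist x a ≤ μ x a := hS.dist_le_surfDist hxS haS
  have hxb : dist x b ≤ μ x b := hS.dist_le_surfDist hxS hbS
  have hax : μ x a = μ a x := surfDist_comm _ _ _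
  have ha3 : μ x a < min δ δ' := by rw [hax, ha2]; exact htv
  have hb3 : μ x b < min δ δ' := by rw [hb1]; exact hty
  have haW : a ∉ warpedSet P := fun haW => by
    have := hmin ⟨haW, show μ v a + μ a y = μ v y by nlinarith⟩
    have : μ v x ≤ μ v a := this
    nlinarith
  have haL : a - x ∉ linealityAt P x := fun h => haW ⟨hP.frontier_subset haS, by
    have := Submodule.finrank_mono
      (hP.convex.linealityAt_le_of_sub_mem hxW.1 (hP.frontier_subset haS) h)
    have := hxW.2
    omega⟩
  have hbx : b ≠ x := by
    rintro rfl
    have : μ b b = 0 := hS.surfDist_self hxS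
    rw [this] at hb1
    have := mul_pos ht0 hxy0
    linarith
  have hlt := hshort a haS b hbS (hxa.trans_lt (ha3.trans_le (min_le_left _ _)))
    (hxb.trans_lt (hb3.trans_le (min_le_left _ _))) haL hbx
  have e1 := hloc a haS (hxa.trans_lt (ha3.trans_le (min_le_right _ _)))
  have e2 := hloc b hbS (hxb.trans_lt (hb3.trans_le (min_le_right _ _)))
  rw [dist_comm a x, ← e1, ← e2, ← hμ, hax] at hlt
  nlinarith

theorem warpedSet_subset_closure :
    warpedSet P ⊆ closure {x | x ∈ P ∧
      Module.finrank ℝ (linealityAt P x) + 3 = Module.finrank ℝ E} := by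
  intro x hx
  have h3 := hx.2
  refine Metric.mem_closure_iff.2 fun ε hε => ?_
  obtain ⟨y, hy, hyx, hr⟩ := hP.exists_finrank_linealityAt_eq_add hx.1
    (Module.finrank ℝ E - 3 - Module.finrank ℝ (linealityAt P x)) (by omega) hε
  exact ⟨y, ⟨hy, by omega⟩, by rwa [dist_comm]⟩

end IsLocallyConicBody

end WarpedPoints

section Degree

/-- A map of a disc to the plane which moves each boundary point by less than the radius has a
zero. -/
theorem exists_eq_zero_of_norm_sub_lt {f : ℂ → ℂ} {ρ : ℝ} (hρ : 0 < ρ)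
    (hf : ContinuousOn f (Metric.closedBall 0 ρ)) (hb : ∀ z, ‖z‖ = ρ → ‖f z - z‖ < ρ) :
    ∃ z ∈ Metric.closedBall (0 : ℂ) ρ, f z = 0 := by
  by_contra! hne
  have hmax : ∀ z : ℂ, max ρ ‖z‖ ≠ 0 := fun z => (hρ.trans_le (le_max_left _ _)).ne'
  let r : ℂ → ℂ := fun z => (ρ / max ρ ‖z‖) • z
  have hr : Continuous r := by
    refine (Continuous.div continuous_const (by fun_prop) hmax).smul continuous_id
  have hrb : ∀ z, r z ∈ Metric.closedBall (0 : ℂ) ρ := fun z => by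
    have h : ‖z‖ ≤ max ρ ‖z‖ := le_max_right _ _
    rw [mem_closedBall_zero_iff, norm_smul, norm_div, Real.norm_of_nonneg hρ.le,
      Real.norm_of_nonneg (hρ.le.trans (le_max_left _ _)), div_mul_eq_mul_div,
      div_le_iff₀ (hρ.trans_le (le_max_left _ _))]
    gcongr
  have hrs : ∀ z : ℂ, ‖z‖ = ρ → r z = z := fun z hz => by
    simp only [r]
    rw [hz, max_self, div_self hρ.ne', one_smul]
  let F : C(ℂ, ℂ) := ⟨fun z => f (r z), hf.comp_continuous hr hrb⟩
  obtain ⟨G, ⟨-, hG⟩, -⟩ := Complex.isCoveringMapOn_exp.existsUnique_continuousMap_lifts F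
    (a₀ := 0) (e₀ := Complex.log (F 0)) (Complex.exp_log (hne _ (hrb 0)))
    fun z => hne _ (hrb z)
  have hG : ∀ z : ℂ, ‖z‖ = ρ → Complex.exp (G z) = f z := fun z hz => by
    have : Complex.exp (G z) = f (r z) := congrFun hG z
    rw [this, hrs z hz]
  let c : ℝ → ℂ := fun θ => ρ * Complex.exp (θ * Complex.I)
  have hcn : ∀ θ, ‖c θ‖ = ρ := fun θ => by simp [c, Complex.norm_exp_ofReal_mul_I, hρ.le]
  have hc0 : ∀ θ, c θ ≠ 0 := fun θ => norm_pos_iff.1 (by rw [hcn]; exact hρ)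
  have hcc : Continuous c := by fun_prop
  have hslit : ∀ θ, f (c θ) / c θ ∈ Complex.slitPlane := fun θ => by
    refine Complex.mem_slitPlane_of_norm_lt_one (z := f (c θ) / c θ - 1) ?_ |> fun h => by
      simpa using h
    rw [div_sub_one (hc0 θ), norm_div, hcn, div_lt_one hρ]
    exact hb _ (hcn θ)
  have hfc : Continuous fun θ => f (c θ) :=
    hf.comp_continuous hcc fun θ => by rw [mem_closedBall_zero_iff, hcn]
  let k : ℝ → ℂ := fun θ => G (c θ) - θ * Complex.I - Complex.log (f (c θ) / c θ)
  have hk : Continuous k := by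
    refine Continuous.sub (by fun_prop) ?_
    exact (hfc.div hcc hc0).clog hslit
  have hexp : ∀ θ, Complex.exp (k θ) = ρ := fun θ => by
    have h1 : f (c θ) ≠ 0 := fun h => Complex.slitPlane_ne_zero (hslit θ) (by rw [h, zero_div])
    simp only [k]
    rw [Complex.exp_sub, Complex.exp_sub, hG _ (hcn θ), Complex.exp_log (div_ne_zero h1 (hc0 θ))]
    have := Complex.exp_ne_zero (θ * Complex.I)
    have h2 := hc0 θ
    simp only [c] at h1 h2 ⊢
    field_simp
  have hcper : c (2 * Real.pi) = c 0 := by simp [c, Complex.exp_two_pi_mul_I]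
  have hkper : (k (2 * Real.pi)).im = (k 0).im - 2 * Real.pi := by
    simp [k, hcper]
    ring
  obtain ⟨θ, -, hθ⟩ : (k 0).im - Real.pi ∈ (fun θ => (k θ).im) '' Icc 0 (2 * Real.pi) := by
    refine intermediate_value_Icc' (by positivity) (by fun_prop) ?_
    rw [hkper]
    constructor <;> linarith [Real.pi_pos]
  have h0 := congrArg Complex.re (hexp 0)
  have h1 := congrArg Complex.re (hexp θ)
  have hθ : (k θ).im = (k 0).im - Real.pi := hθ
  rw [Complex.exp_re, Complex.ofReal_re] at h0 h1
  rw [hθ, Real.cos_sub_pi] at h1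
  have hcos : 0 < Real.cos (k 0).im := by
    refine pos_of_mul_pos_right (h0 ▸ hρ) (Real.exp_pos _).le
  have := mul_pos (Real.exp_pos (k θ).re) hcos
  linarith

end Degree

section Assembly

variable {E : Type*} [NormedAddCommGroup E] [InnerProductSpace ℝ E] {P : Set E}

theorem exists_clm_complex_ker_eq [FiniteDimensional ℝ E] (K : Submodule ℝ E)
    (hK : Module.finrank ℝ K + 2 = Module.finrank ℝ E) :
    ∃ (p : E →L[ℝ] ℂ) (ι : ℂ →L[ℝ] E), (∀ w, p w = 0 ↔ w ∈ K) ∧ ∀ z, p (ι z) = z := by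
  have h := K.finrank_quotient_add_finrank
  let φ : (E ⧸ K) ≃ₗ[ℝ] ℂ := LinearEquiv.ofFinrankEq _ _ (by
    rw [Complex.finrank_real_complex]; omega)
  let q : E →ₗ[ℝ] ℂ := φ.toLinearMap ∘ₗ K.mkQ
  have hq : Function.Surjective q := φ.surjective.comp K.mkQ_surjective
  obtain ⟨j, hj⟩ := q.exists_rightInverse_of_surjective (LinearMap.range_eq_top.2 hq)
  refine ⟨LinearMap.toContinuousLinearMap q, LinearMap.toContinuousLinearMap j, fun w => ?_,
    fun z => LinearMap.congr_fun hj z⟩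
  simp [q]

/-- A convex body is parametrized radially from an interior point: the ray from `c` with direction
`w` leaves the body at `c + (g w)⁻¹ • w`. -/
theorem exists_radial_function (hP : Convex ℝ P) {c : E} (hc : c ∈ interior P) :
    ∃ g : E → ℝ, Continuous g ∧ (∀ w, c + w ∈ frontier P → g w = 1) ∧
      ∀ w, 0 < g w → c + (g w)⁻¹ • w ∈ frontier P := by
  set Q : Set E := (Homeomorph.addLeft c) ⁻¹' P with hQ
  have hQc : Convex ℝ Q := hP.translate_preimage_right c
  have hQ0 : Q ∈ 𝓝 (0 : E) := by
    refine (Homeomorph.addLeft c).continuous.continuousAt.preimage_mem_nhds ?_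
    simpa using mem_interior_iff_mem_nhds.1 hc
  have hfr : ∀ w, gauge Q w = 1 ↔ c + w ∈ frontier P := fun w => by
    rw [gauge_eq_one_iff_mem_frontier hQc hQ0, hQ, ← Homeomorph.preimage_frontier]
    rfl
  refine ⟨gauge Q, continuous_gauge hQc hQ0, fun w => (hfr w).2, fun w hw => ?_⟩
  rw [← hfr, gauge_smul_of_nonneg (inv_nonneg.2 hw.le), smul_eq_mul, inv_mul_cancel₀ hw.ne']

namespace IsLocallyConicBody

variable [FiniteDimensional ℝ E] (hP : IsLocallyConicBody P)
include hP

theorem exists_mem_warpedSet_of_sub_mem {x e : E} (hx : x ∈ warpedSet P)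
    (he : x + e ∈ interior P) :
    ∃ δ > 0, ∀ y ∈ frontier P, dist y x < δ →
      y - x ∈ linealityAt P x ⊔ Submodule.span ℝ {e} → y ∈ warpedSet P := by
  obtain ⟨δ, hδ, hprol⟩ := hP.exists_prolong x hx.1
  refine ⟨δ, hδ, fun y hy hyx hmem => ?_⟩
  have hyP := hP.frontier_subset hy
  obtain ⟨l, hl, w, hw, hlw⟩ := Submodule.mem_sup.1 hmem
  obtain ⟨h, rfl⟩ := Submodule.mem_span_singleton.1 hw
  obtain ⟨τ, hτ, h1, h2⟩ := (hP.convex.mem_linealityAt hx.1).1 hl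
  rcases lt_trichotomy h 0 with hh | rfl | hh
  · exfalso
    have heL : e ∉ linealityAt P x := fun h =>
      (hP.frontier_eq ▸ hP.warpedSet_subset_frontier hx).2
        (hP.convex.mem_interior_of_sub_mem hx.1 he (by simpa))
    rcases hP.convex.forall_notMem_or_of_notMem_linealityAt hx.1 heL with h' | h'
    · exact h' 1 one_pos (by simpa using interior_subset he)
    · have hm : 0 < min 1 τ := lt_min one_pos hτ
      refine h' (min 1 τ / 2 * -h) (mul_pos (half_pos hm) (neg_pos.2 hh)) ?_
      have ha := hP.convex.add_smul_mem_of_le hx.1 (w := y - x) (t := 1) (s := min 1 τ)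
        (by simpa) hm.le (min_le_left _ _)
      have hb := hP.convex.add_smul_mem_of_le hx.1 (w := -l) (t := τ) (s := min 1 τ)
        (by rwa [smul_neg, ← sub_eq_add_neg]) hm.le (min_le_right _ _)
      have := hP.convex ha hb (a := 1 / 2) (b := 1 / 2) (by norm_num) (by norm_num) (by norm_num)
      convert this using 1
      rw [← hlw]
      module
  · rw [zero_smul, add_zero] at hlw
    refine ⟨hyP, le_trans ?_ hx.2⟩
    gcongr
    exact Submodule.finrank_mono (hP.convex.linealityAt_le_of_sub_mem hx.1 hyP (hlw ▸ hl))
  · exfalso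
    obtain ⟨ε, hε, hyε⟩ := hprol y hyP hyx
    set m := min (min 1 τ) (1 / h) with hm
    have hm0 : 0 < m := by positivity
    have hm1 : m * h ≤ 1 := by
      rw [← le_div_iff₀ hh]
      exact min_le_right _ _
    have ha : x + m • l ∈ P := hP.convex.add_smul_mem_of_le hx.1 h1 hm0.le
      ((min_le_left _ _).trans (min_le_right _ _))
    have hb : x + (m * h) • e ∈ interior P := hP.convex.add_smul_mem_interior hx.1 he
      ⟨by positivity, hm1⟩
    have hmid := hP.convex.add_smul_sub_mem_interior ha hb (t := 1 / 2) ⟨by norm_num, by norm_num⟩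
    refine (hP.frontier_eq ▸ hy).2 (hP.convex.mem_interior_of_sub_mem hyP hmid ?_)
    have hL := hP.convex.sub_mem_linealityAt_of_prolong hx.1 hyP hε hyε
    convert Submodule.smul_mem _ (m / 2 - 1) hL using 1
    have hy' : y = x + (l + h • e) := by rw [hlw]; abel
    rw [hy']
    module

theorem mem_closure_isCutPoint_of_finrank_eq {v x : E} (hv : v ∈ frontier P)
    (hvW : v ∉ warpedSet P) (hx : x ∈ P)
    (hdim : Module.finrank ℝ (linealityAt P x) + 3 = Module.finrank ℝ E) :
    x ∈ closure {y | IsCutPoint P v y} := by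
  have hxW : x ∈ warpedSet P := ⟨hx, hdim.le⟩
  have hxS := hP.warpedSet_subset_frontier hxW
  have hS := hP.isGeodesicCompact_frontier (by omega)
  by_contra hcl
  obtain ⟨r, hr, hball⟩ := Metric.isOpen_iff.1 isClosed_closure.isOpen_compl x hcl
  obtain ⟨c, hc⟩ := hP.interior_nonempty
  have he : x + (c - x) ∈ interior P := by rwa [add_sub_cancel]
  have heL : c - x ∉ linealityAt P x := fun h =>
    (hP.frontier_eq ▸ hxS).2 (hP.convex.mem_interior_of_sub_mem hx hc h)
  obtain ⟨δ, hδ, hwarp⟩ := hP.exists_mem_warpedSet_of_sub_mem hxW he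
  obtain ⟨p, ι, hp, hpι⟩ := exists_clm_complex_ker_eq
    (linealityAt P x ⊔ Submodule.span ℝ {c - x}) (by
      rw [Submodule.finrank_sup_span_singleton heL]; omega)
  have hpe : p (c - x) = 0 := (hp _).2
    (le_sup_right (a := linealityAt P x) (Submodule.mem_span_singleton_self _))
  obtain ⟨gg, hgc, hg1, hgfr⟩ := exists_radial_function hP.convex hc
  let g : ℂ → ℝ := fun z => gg (ι z - (c - x))
  let s : ℂ → E := fun z => c + (g z)⁻¹ • (ι z - (c - x))
  have hg : Continuous g := hgc.comp (by fun_prop)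
  have hg0 : g 0 = 1 := hg1 _ (by simpa)
  have hs0 : s 0 = x := by simp [s, hg0]
  have hsc : ∀ z, 0 < g z → ContinuousAt s z := fun z hz =>
    continuousAt_const.add ((hg.continuousAt.inv₀ hz.ne').smul (by fun_prop))
  have hps : ∀ z, 0 < g z → g z * p (s z - x) = z := fun z hz => by
    have hz' : (g z : ℂ) ≠ 0 := by exact_mod_cast hz.ne'
    rw [show s z - x = (c - x) + (g z)⁻¹ • (ι z - (c - x)) by simp only [s]; abel, map_add,
      hpe, map_smul, map_sub p (ι z), hpe, hpι, zero_add, sub_zero, Complex.real_smul, Complex.ofReal_inv,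
      mul_inv_cancel_left₀ hz']
  have hev : ∀ᶠ z in 𝓝 (0 : ℂ), (0 < g z ∧ g z < 2) ∧ dist (s z) x < min r (δ / 2) := by
    refine ((hg.tendsto' 0 1 hg0).eventually (Ioo_mem_nhds one_pos one_lt_two)).and ?_
    have := hsc 0 (by rw [hg0]; exact one_pos)
    rw [ContinuousAt, hs0] at this
    exact this.eventually (Metric.ball_mem_nhds x (by positivity))
  obtain ⟨ρ, hρ, hρball⟩ := Metric.nhds_basis_closedBall.eventually_iff.1 hev
  have hη : 0 < min (δ / 2) (ρ / (2 * ‖p‖ + 1)) := by positivity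
  set η := min (δ / 2) (ρ / (2 * ‖p‖ + 1)) with hη'
  obtain ⟨D, hD⟩ := hS.isCompact.exists_bound_of_continuousOn (hS.continuousOn_surfDist hv)
  have hD0 : 0 ≤ D := (norm_nonneg _).trans (hD x hxS)
  set t : ℝ := min (1 / 2) (η / (D + 1)) with ht
  have ht0 : 0 < t := by positivity
  have ht1 : t ≤ 1 / 2 := min_le_left _ _
  have htD : t * D < η := by
    have : t * (D + 1) ≤ η := by
      rw [← le_div_iff₀ (by positivity)]
      exact min_le_right _ _
    linarith
  have hex : ∀ y, ∃ z, y ∈ frontier P → z ∈ frontier P ∧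
      surfDist (frontier P) v z = (1 - t) * surfDist (frontier P) v y ∧
      surfDist (frontier P) z y = (1 - (1 - t)) * surfDist (frontier P) v y := by
    intro y
    by_cases hy : y ∈ frontier P
    · obtain ⟨z, hz⟩ := hS.exists_between hv hy (t := 1 - t) ⟨by linarith, by linarith⟩
      exact ⟨z, fun _ => hz⟩
    · exact ⟨y, fun h => absurd h hy⟩
  choose ζ hζ using hex
  have hζc : ContinuousOn ζ (frontier P ∩ Metric.ball x r) := by
    refine hS.continuousOn_between hv inter_subset_left ?_ fun y hy => hζ y hy.1
    intro y hy γ₁ γ₂ h₁ h₂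
    by_contra hne
    exact hball hy.2 (subset_closure ⟨γ₁, γ₂, h₁, h₂, hne⟩)
  have hζd : ∀ y ∈ frontier P, dist (ζ y) y < η := fun y hy => by
    obtain ⟨h1, h2, h3⟩ := hζ y hy
    refine (hS.dist_le_surfDist h1 hy).trans_lt ?_
    rw [h3, sub_sub_cancel]
    refine lt_of_le_of_lt ?_ htD
    gcongr
    exact (le_abs_self _).trans (hD y hy)
  have hζW : ∀ y ∈ frontier P, ζ y ∉ warpedSet P := fun y hy hW => by
    obtain ⟨h1, h2, h3⟩ := hζ y hy
    refine hP.surfDist_ne_add_of_mem_warpedSet hv hvW hy hW (fun heq => ?_) (by rw [h2, h3]; ring)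
    rw [heq] at h2
    have h0 : surfDist (frontier P) v y = 0 := by nlinarith
    rw [heq, ← hS.eq_of_surfDist_eq_zero hv hy h0] at hW
    exact hvW hW
  have hsS : ∀ z ∈ Metric.closedBall (0 : ℂ) ρ, s z ∈ frontier P := fun z hz =>
    hgfr _ (hρball hz).1.1
  have hfc : ContinuousOn (fun z => g z * p (ζ (s z) - x)) (Metric.closedBall 0 ρ) := by
    refine ((Complex.continuous_ofReal.comp hg).continuousOn).mul ?_
    refine p.continuous.comp_continuousOn (ContinuousOn.sub ?_ continuousOn_const)
    refine hζc.comp (fun z hz => (hsc z (hρball hz).1.1).continuousWithinAt) fun z hz => ?_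
    exact ⟨hsS z hz, (hρball hz).2.trans_le (min_le_left _ _)⟩
  obtain ⟨z, hz, hz0⟩ := exists_eq_zero_of_norm_sub_lt hρ hfc fun z hz => by
    have hzb : z ∈ Metric.closedBall (0 : ℂ) ρ := by rw [mem_closedBall_zero_iff, hz]
    have hgz := (hρball hzb).1
    have e : g z * p (ζ (s z) - x) - z = g z * p (ζ (s z) - s z) := by
      nth_rewrite 3 [← hps z hgz.1]
      rw [← mul_sub, ← map_sub, sub_sub_sub_cancel_right]
    rw [e, norm_mul, Complex.norm_real, Real.norm_of_nonneg hgz.1.le]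
    have h1 := p.le_opNorm (ζ (s z) - s z)
    have h2 := hζd (s z) (hsS z hzb)
    rw [dist_eq_norm] at h2
    have h3 : η * (2 * ‖p‖ + 1) ≤ ρ := by
      rw [← le_div_iff₀ (by positivity)]
      exact min_le_right _ _
    have h4 : ‖p‖ * ‖ζ (s z) - s z‖ ≤ ‖p‖ * η := by gcongr
    nlinarith [norm_nonneg (p (ζ (s z) - s z))]
  have hgz := (hρball hz).1.1
  have hpz : p (ζ (s z) - x) = 0 :=
    (mul_eq_zero.1 hz0).resolve_left (by exact_mod_cast hgz.ne')
  refine hζW (s z) (hsS z hz) (hwarp _ (hζ _ (hsS z hz)).1 ?_ ((hp _).1 hpz))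
  have h1 := (hζd (s z) (hsS z hz)).trans_le (min_le_left _ _)
  have h2 := (hρball hz).2.trans_le (min_le_right _ _)
  exact (dist_triangle _ (s z) _).trans_lt (by linarith)

theorem warpedSet_subset_closure_isCutPoint {v : E} (hv : v ∈ frontier P)
    (hvW : v ∉ warpedSet P) : warpedSet P ⊆ closure {y | IsCutPoint P v y} :=
  hP.warpedSet_subset_closure.trans (closure_minimal
    (fun _ hx => hP.mem_closure_isCutPoint_of_finrank_eq hv hvW hx.1 hx.2) isClosed_closure)

end IsLocallyConicBody

end Assembly

end Warped

/-- Proposition 2.5: every warped point (point of a face of `P` of dimension at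
most `d - 2`) lies in the cut locus, i.e. in the closure of the set `K_v` of
cut points. -/
theorem warped_subset_closure_cutPoints {d : ℕ} (hd : 1 ≤ d)
    (P : Set (EuclideanSpace ℝ (Fin (d + 1))))
    (hP : ∃ A : Finset (EuclideanSpace ℝ (Fin (d + 1))),
      P = convexHull ℝ (A : Set (EuclideanSpace ℝ (Fin (d + 1)))))
    (hint : (interior P).Nonempty)
    (v : EuclideanSpace ℝ (Fin (d + 1)))
    (hv : ∃ F : Set (EuclideanSpace ℝ (Fin (d + 1))),
      IsFace P F ∧ faceDim F = d ∧ v ∈ intrinsicInterior ℝ F) :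
    ∀ x : EuclideanSpace ℝ (Fin (d + 1)),
      (∃ F : Set (EuclideanSpace ℝ (Fin (d + 1))),
        IsFace P F ∧ faceDim F + 2 ≤ d ∧ x ∈ F) →
      x ∈ closure {y : EuclideanSpace ℝ (Fin (d + 1)) | IsCutPoint P v y} := by
  rintro x ⟨F, hF, hFd, hxF⟩
  have hbody : IsLocallyConicBody P := by
    obtain ⟨A, rfl⟩ := hP
    exact isLocallyConicBody_convexHull A hint
  obtain ⟨G, hG, hGd, hvG⟩ := hv
  have hn : Module.finrank ℝ (EuclideanSpace ℝ (Fin (d + 1))) = d + 1 := by simp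
  have hGP : G ⊆ P := hG.2.2.1
  have hvG' : v ∈ G := intrinsicInterior_subset hvG
  have hle := Submodule.finrank_mono (hG.linealityAt_le_direction hbody.convex hvG')
  have hge := Submodule.finrank_mono (direction_le_linealityAt hGP hvG)
  have hleF := Submodule.finrank_mono (hF.linealityAt_le_direction hbody.convex hxF)
  rw [faceDim] at hFd hGd
  refine hbody.warpedSet_subset_closure_isCutPoint ?_ (fun h => ?_) ⟨hF.2.2.1 hxF, by omega⟩
  · rw [hbody.frontier_eq]
    exact ⟨hGP hvG', hbody.convex.notMem_interior_of_finrank_lt (by omega)⟩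
  · have := h.2
    omega
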